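/- arXiv:2510.15295 — 7 statements merged into one kernel-verified Lean document; each statement's English description precedes it below -/
import Mathlib

section
/- Let M be a positive integer, let h_c, h_t ∈ ℂ^M be nonzero vectors, let P > 0, σ² > 0 and Γ̃ > 0, and define the correlation coefficient ρ = |⟨h_c, h_t⟩| / (‖h_c‖·‖h_t‖) ∈ [0,1]. If P·ρ²·‖h_t‖² ≥ Γ̃, then the supremum of |⟨h_c, w⟩|²/σ² over all w ∈ ℂ^M satisfying ‖w‖² ≤ P and |⟨h_t, w⟩|² ≥ Γ̃ equals P·‖h_c‖²/σ², and it is attained at w = √P · h_c/‖h_c‖. -/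
open scoped ComplexInnerProductSpace

/-- Lemma 1, first case: if `P·ρ²·‖h_t‖² ≥ Γ̃`, the supremum of
`|⟨h_c, w⟩|²/σ²` over `w` with `‖w‖² ≤ P` and `|⟨h_t, w⟩|² ≥ Γ̃` equals `P·‖h_c‖²/σ²`,
attained at `w = √P · h_c/‖h_c‖`. -/
theorem stmt_0 (M : ℕ) (hM : 0 < M) (hc ht : EuclideanSpace ℂ (Fin M))
    (hhc : hc ≠ 0) (hht : ht ≠ 0)
    (P σ2 Γ : ℝ) (hP : 0 < P) (hσ : 0 < σ2) (hΓ : 0 < Γ)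
    (ρ : ℝ) (hρ : ρ = ‖⟪hc, ht⟫‖ / (‖hc‖ * ‖ht‖))
    (hcase : P * ρ ^ 2 * ‖ht‖ ^ 2 ≥ Γ) :
    IsGreatest
      {x : ℝ | ∃ w : EuclideanSpace ℂ (Fin M),
        ‖w‖ ^ 2 ≤ P ∧ Γ ≤ ‖⟪ht, w⟫‖ ^ 2 ∧ x = ‖⟪hc, w⟫‖ ^ 2 / σ2}
      (P * ‖hc‖ ^ 2 / σ2) ∧
    (‖((Real.sqrt P / ‖hc‖ : ℝ) • hc : EuclideanSpace ℂ (Fin M))‖ ^ 2 ≤ P ∧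
     Γ ≤ ‖⟪ht, ((Real.sqrt P / ‖hc‖ : ℝ) • hc : EuclideanSpace ℂ (Fin M))⟫‖ ^ 2 ∧
     ‖⟪hc, ((Real.sqrt P / ‖hc‖ : ℝ) • hc : EuclideanSpace ℂ (Fin M))⟫‖ ^ 2 / σ2
        = P * ‖hc‖ ^ 2 / σ2) := by
  have hcp : 0 < ‖hc‖ := norm_pos_iff.mpr hhc
  have htp : 0 < ‖ht‖ := norm_pos_iff.mpr hht
  have hsq : Real.sqrt P ^ 2 = P := Real.sq_sqrt hP.le
  have hin : ∀ v : EuclideanSpace ℂ (Fin M),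
      ‖⟪v, ((Real.sqrt P / ‖hc‖ : ℝ) • hc : EuclideanSpace ℂ (Fin M))⟫‖ ^ 2
        = P / ‖hc‖ ^ 2 * ‖⟪v, hc⟫‖ ^ 2 := by
    intro v
    rw [inner_smul_right_eq_smul, norm_smul, mul_pow, Real.norm_eq_abs, sq_abs, div_pow, hsq]
  have h1 : ‖((Real.sqrt P / ‖hc‖ : ℝ) • hc : EuclideanSpace ℂ (Fin M))‖ ^ 2 ≤ P := by
    rw [norm_smul, mul_pow, Real.norm_eq_abs, sq_abs, div_pow, hsq]
    apply le_of_eq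
    field_simp
  have h2 : Γ ≤ ‖⟪ht, ((Real.sqrt P / ‖hc‖ : ℝ) • hc : EuclideanSpace ℂ (Fin M))⟫‖ ^ 2 := by
    rw [hin, norm_inner_symm]
    refine hcase.le.trans (le_of_eq ?_)
    rw [hρ]
    field_simp
  have h3 : ‖⟪hc, ((Real.sqrt P / ‖hc‖ : ℝ) • hc : EuclideanSpace ℂ (Fin M))⟫‖ ^ 2 / σ2
      = P * ‖hc‖ ^ 2 / σ2 := by
    have h4 : ‖⟪hc, hc⟫‖ = ‖hc‖ ^ 2 := by
      rw [inner_self_eq_norm_sq_to_K]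
      simp
    rw [hin, h4]
    field_simp
  refine ⟨⟨⟨_, h1, h2, h3.symm⟩, ?_⟩, h1, h2, h3⟩
  rintro x ⟨w, hw, -, rfl⟩
  have h5 : ‖⟪hc, w⟫‖ ≤ ‖hc‖ * ‖w‖ := norm_inner_le_norm hc w
  have h6 : ‖⟪hc, w⟫‖ ^ 2 ≤ P * ‖hc‖ ^ 2 := by
    calc ‖⟪hc, w⟫‖ ^ 2 ≤ (‖hc‖ * ‖w‖) ^ 2 := by gcongr
      _ = ‖w‖ ^ 2 * ‖hc‖ ^ 2 := by ring
      _ ≤ P * ‖hc‖ ^ 2 := by gcongr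
  gcongr
end

section
/- Let M be a positive integer, let h_c, h_t ∈ ℂ^M be nonzero vectors, let P > 0, σ² > 0 and Γ̃ > 0, and define the correlation coefficient ρ = |⟨h_c, h_t⟩| / (‖h_c‖·‖h_t‖) ∈ [0,1]. If P·ρ²·‖h_t‖² < Γ̃ ≤ P·‖h_t‖², then the supremum of |⟨h_c, w⟩|²/σ² over all w ∈ ℂ^M satisfying ‖w‖² ≤ P and |⟨h_t, w⟩|² ≥ Γ̃ equals g(ρ) = (‖h_c‖² / (σ²·‖h_t‖²)) · ( ρ·√Γ̃ + √(1−ρ²)·√(‖h_t‖²·P − Γ̃) )². -/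
open scoped ComplexInnerProductSpace

lemma aux_decomp {E : Type*} [NormedAddCommGroup E] [InnerProductSpace ℂ E] (e x y : E)
    (he : ‖e‖ = 1) :
    ⟪x, y⟫ = ⟪x, e⟫ * ⟪e, y⟫ + ⟪x - ⟪e, x⟫ • e, y - ⟪e, y⟫ • e⟫ := by
  have h1 : ⟪e, e⟫ = 1 := by rw [inner_self_eq_norm_sq_to_K, he]; simp
  simp only [inner_sub_left, inner_sub_right, inner_smul_left, inner_smul_right, h1,
    inner_conj_symm]
  ring

lemma aux_norm {E : Type*} [NormedAddCommGroup E] [InnerProductSpace ℂ E] (e x : E)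
    (he : ‖e‖ = 1) :
    ‖x‖ ^ 2 = ‖⟪e, x⟫‖ ^ 2 + ‖x - ⟪e, x⟫ • e‖ ^ 2 := by
  have h := aux_decomp e x x he
  rw [inner_self_eq_norm_sq_to_K, inner_self_eq_norm_sq_to_K, ← inner_conj_symm x e,
    Complex.conj_mul'] at h
  apply Complex.ofReal_injective
  push_cast
  exact h

lemma aux_real (ρ r q k s t : ℝ) (hρ : 0 ≤ ρ) (hr : 0 ≤ r) (hq : 0 < q) (hk : 0 ≤ k)
    (hs : q ≤ s) (ht : 0 ≤ t) (h : s ^ 2 + t ^ 2 ≤ q ^ 2 + k ^ 2) (h2 : ρ * k ≤ r * q) :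
    ρ * s + r * t ≤ ρ * q + r * k := by
  have htk : t ≤ k := by nlinarith
  have h3 : q * (s - q) ≤ k * (k - t) := by nlinarith [sq_nonneg (s - q), sq_nonneg (t - k)]
  have h4 := mul_le_mul_of_nonneg_left h3 hρ
  have h5 := mul_le_mul_of_nonneg_right h2 (sub_nonneg.2 htk)
  have h6 : q * (ρ * (s - q)) ≤ q * (r * (k - t)) := by linarith
  have := le_of_mul_le_mul_left h6 hq
  linarith


/-- Lemma 1, second case: if `P·ρ²·‖h_t‖² < Γ̃ ≤ P·‖h_t‖²`, the supremum of
`|⟨h_c, w⟩|²/σ²` over `w` with `‖w‖² ≤ P` and `|⟨h_t, w⟩|² ≥ Γ̃` equals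
`g(ρ) = (‖h_c‖²/(σ²‖h_t‖²))·(ρ√Γ̃ + √(1−ρ²)·√(‖h_t‖²P − Γ̃))²`. -/
theorem stmt_1 (M : ℕ) (hM : 0 < M) (hc ht : EuclideanSpace ℂ (Fin M))
    (hhc : hc ≠ 0) (hht : ht ≠ 0)
    (P σ2 Γ : ℝ) (hP : 0 < P) (hσ : 0 < σ2) (hΓ : 0 < Γ)
    (ρ : ℝ) (hρ : ρ = ‖⟪hc, ht⟫‖ / (‖hc‖ * ‖ht‖))
    (hcase1 : P * ρ ^ 2 * ‖ht‖ ^ 2 < Γ) (hcase2 : Γ ≤ P * ‖ht‖ ^ 2) :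
    IsLUB
      {x : ℝ | ∃ w : EuclideanSpace ℂ (Fin M),
        ‖w‖ ^ 2 ≤ P ∧ Γ ≤ ‖⟪ht, w⟫‖ ^ 2 ∧ x = ‖⟪hc, w⟫‖ ^ 2 / σ2}
      (‖hc‖ ^ 2 / (σ2 * ‖ht‖ ^ 2) *
        (ρ * Real.sqrt Γ + Real.sqrt (1 - ρ ^ 2) * Real.sqrt (‖ht‖ ^ 2 * P - Γ)) ^ 2) := by

  have hT : 0 < ‖ht‖ := norm_pos_iff.2 hht
  have hC : 0 < ‖hc‖ := norm_pos_iff.2 hhc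
  set T := ‖ht‖ with hTd
  set C := ‖hc‖ with hCd
  have hT0 : (T : ℂ) ≠ 0 := by exact_mod_cast hT.ne'
  obtain ⟨e, he⟩ : ∃ e : EuclideanSpace ℂ (Fin M), e = ((T : ℂ)⁻¹) • ht := ⟨_, rfl⟩
  have he1 : ‖e‖ = 1 := by
    rw [he, norm_smul, norm_inv, Complex.norm_real, Real.norm_of_nonneg hT.le, ← hTd]
    field_simp
  have hte : ht = (T : ℂ) • e := by rw [he, smul_smul, mul_inv_cancel₀ hT0, one_smul]
  have htw : ∀ w, ‖⟪ht, w⟫‖ = T * ‖⟪e, w⟫‖ := fun w => by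
    rw [hte, inner_smul_left, norm_mul, RCLike.norm_conj, Complex.norm_real,
      Real.norm_of_nonneg hT.le]
  have hρ0 : 0 ≤ ρ := by rw [hρ]; positivity
  have ha : ‖⟪hc, e⟫‖ = C * ρ := by
    rw [hρ, norm_inner_symm hc ht, htw, norm_inner_symm]; field_simp
  have hρ1 : ρ ^ 2 < 1 := by
    have : P * T ^ 2 * ρ ^ 2 < P * T ^ 2 * 1 := by linarith
    exact lt_of_mul_lt_mul_left this (by positivity)
  obtain ⟨u, hu⟩ : ∃ u, u = hc - ⟪e, hc⟫ • e := ⟨_, rfl⟩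
  obtain ⟨r, hrd⟩ : ∃ r, r = √(1 - ρ ^ 2) := ⟨_, rfl⟩
  obtain ⟨q, hqd⟩ : ∃ q, q = √Γ := ⟨_, rfl⟩
  obtain ⟨k, hkd⟩ : ∃ k, k = √(T ^ 2 * P - Γ) := ⟨_, rfl⟩
  have hr : 0 < r := by rw [hrd]; exact Real.sqrt_pos.2 (by linarith)
  have hq : 0 < q := by rw [hqd]; exact Real.sqrt_pos.2 hΓ
  have hk : 0 ≤ k := by rw [hkd]; positivity
  have hr2 : r ^ 2 = 1 - ρ ^ 2 := by rw [hrd]; exact Real.sq_sqrt (by linarith)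
  have hq2 : q ^ 2 = Γ := by rw [hqd]; exact Real.sq_sqrt hΓ.le
  have hk2 : k ^ 2 = T ^ 2 * P - Γ := by rw [hkd]; exact Real.sq_sqrt (by linarith)
  rw [← hrd, ← hqd, ← hkd]
  have hun : ‖u‖ = C * r := by
    have h := aux_norm e hc he1
    rw [norm_inner_symm, ha, ← hu, ← hCd] at h
    rw [← sq_eq_sq₀ (norm_nonneg _) (by positivity), mul_pow, hr2]
    linarith
  constructor
  · rintro x ⟨w, hw1, hw2, rfl⟩
    have hd := aux_decomp e hc w he1
    have hn := aux_norm e w he1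
    rw [← hu] at hd
    obtain ⟨v, hv⟩ : ∃ v, v = w - ⟪e, w⟫ • e := ⟨_, rfl⟩
    rw [← hv] at hd hn
    have hle : ‖⟪hc, w⟫‖ ≤ C * ρ * ‖⟪e, w⟫‖ + C * r * ‖v‖ := by
      rw [hd, ← ha, ← hun, ← norm_mul]
      exact (norm_add_le _ _).trans (add_le_add_right (norm_inner_le_norm _ _) _)
    rw [htw] at hw2
    have hreal := aux_real ρ r q k (T * ‖⟪e, w⟫‖) (T * ‖v‖) hρ0 hr.le hq hk
      (by rw [hqd]; exact Real.sqrt_le_iff.2 ⟨by positivity, hw2⟩) (by positivity)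
      (by
        have := mul_le_mul_of_nonneg_left hw1 (sq_nonneg T)
        rw [hn] at this
        linarith)
      (by
        refine (sq_le_sq₀ (by positivity) (by positivity)).1 ?_
        rw [mul_pow, mul_pow, hr2, hk2, hq2]
        linarith)
    have h1 : T * ‖⟪hc, w⟫‖ ≤ C * (ρ * q + r * k) := by
      have h2 := mul_le_mul_of_nonneg_left hle hT.le
      have h3 := mul_le_mul_of_nonneg_left hreal hC.le
      linarith
    have h2 := pow_le_pow_left₀ (by positivity) h1 2
    rw [div_mul_eq_mul_div, div_le_div_iff₀ hσ (by positivity)]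
    have h3 := mul_le_mul_of_nonneg_left h2 hσ.le
    linarith
  · intro b hb
    apply hb
    obtain ⟨ζ, hζ, hζ2⟩ := RCLike.exists_norm_eq_mul_self (⟪hc, e⟫)
    have hee : ⟪e, e⟫ = 1 := by rw [inner_self_eq_norm_sq_to_K, he1]; simp
    have heu : ⟪e, u⟫ = 0 := by
      rw [hu, inner_sub_right, inner_smul_right, hee]; ring
    have hcu : ⟪hc, u⟫ = ((C * r : ℝ) : ℂ) ^ 2 := by
      have : hc = u + ⟪e, hc⟫ • e := by rw [hu]; abel
      rw [this, inner_add_left, inner_smul_left, heu, inner_self_eq_norm_sq_to_K, hun]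
      simp
    have hCr : ((C * r : ℝ) : ℂ) ≠ 0 := by exact_mod_cast (mul_pos hC hr).ne'
    obtain ⟨w, hw⟩ : ∃ w, w = (ζ * ((q / T : ℝ) : ℂ)) • e + ((k / T / (C * r) : ℝ) : ℂ) • u :=
      ⟨_, rfl⟩
    have hew : ⟪e, w⟫ = ζ * ((q / T : ℝ) : ℂ) := by
      rw [hw, inner_add_right, inner_smul_right, inner_smul_right, hee, heu]; ring
    have hewn : ‖⟪e, w⟫‖ = q / T := by
      rw [hew, norm_mul, hζ, Complex.norm_real, Real.norm_of_nonneg (by positivity), one_mul]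
    have hcw : ⟪hc, w⟫ = ((C * ρ * (q / T) + k / T * (C * r) : ℝ) : ℂ) := by
      rw [hw, inner_add_right, inner_smul_right, inner_smul_right, hcu, mul_right_comm,
        ← hζ2, ha]
      push_cast at hCr ⊢
      field_simp
      simp
      ring
    refine ⟨w, ?_, ?_, ?_⟩
    · rw [aux_norm e w he1, hewn]
      have : w - ⟪e, w⟫ • e = ((k / T / (C * r) : ℝ) : ℂ) • u := by
        rw [hew, hw]; abel
      rw [this, norm_smul, hun, Complex.norm_real, Real.norm_of_nonneg (by positivity),
        div_mul_cancel₀ _ (by positivity), div_pow, div_pow, hq2, hk2]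
      apply le_of_eq
      field_simp
      ring
    · rw [htw, hewn, mul_div_cancel₀ _ hT.ne', hq2]
    · rw [hcw, Complex.norm_real, Real.norm_of_nonneg (by positivity)]
      field_simp
end

section
/- Let q_u, q_t ∈ ℝ² with D_h = ‖q_u − q_t‖, let A > 0, B > 0, H > 0, and let 0 < Γ_th ≤ B/H². Then the supremum of R(q) = log₂(1 + A/(‖q − q_u‖² + H²)) over the set S = { q ∈ ℝ² : B/(‖q − q_t‖² + H²) ≥ Γ_th } equals: log₂(1 + A/H²) if Γ_th ≤ B/(D_h² + H²), and log₂(1 + A/((D_h − √(B/Γ_th − H²))² + H²)) if B/(D_h² + H²) < Γ_th ≤ B/H²; and this supremum is attained. -/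
/-- closed form (17) of Theorem 2: the supremum of
`R(q) = log₂(1 + A/(‖q − q_u‖² + H²))` over `S = {q : B/(‖q − q_t‖² + H²) ≥ Γ_th}` equals
`log₂(1 + A/H²)` if `Γ_th ≤ B/(D_h² + H²)`, and
`log₂(1 + A/((D_h − √(B/Γ_th − H²))² + H²))` otherwise, and it is attained. -/
theorem stmt_10 (qu qt : EuclideanSpace ℝ (Fin 2)) (A B H Γth : ℝ)
    (hA : 0 < A) (hB : 0 < B) (hH : 0 < H) (hΓ : 0 < Γth) (hΓle : Γth ≤ B / H ^ 2)
    (Dh : ℝ) (hDh : Dh = ‖qu - qt‖) :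
    IsGreatest
      {x : ℝ | ∃ q : EuclideanSpace ℝ (Fin 2),
        Γth ≤ B / (‖q - qt‖ ^ 2 + H ^ 2) ∧
        x = Real.logb 2 (1 + A / (‖q - qu‖ ^ 2 + H ^ 2))}
      (if Γth ≤ B / (Dh ^ 2 + H ^ 2) then Real.logb 2 (1 + A / H ^ 2)
       else Real.logb 2
          (1 + A / ((Dh - Real.sqrt (B / Γth - H ^ 2)) ^ 2 + H ^ 2))) := by
  have hmono : ∀ x y : ℝ, 0 ≤ x → x ≤ y →
      Real.logb 2 (1 + A / (y ^ 2 + H ^ 2)) ≤ Real.logb 2 (1 + A / (x ^ 2 + H ^ 2)) := by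
    intro x y hx hxy
    apply Real.logb_le_logb_of_le (by norm_num) (by positivity)
    gcongr
  have h0 : 0 ≤ B / Γth - H ^ 2 := by
    rw [le_div_iff₀ (by positivity)] at hΓle
    rw [sub_nonneg, le_div_iff₀ hΓ]
    linarith
  have hfeas : ∀ x : ℝ, 0 ≤ x →
      (Γth ≤ B / (x ^ 2 + H ^ 2) ↔ x ≤ Real.sqrt (B / Γth - H ^ 2)) := by
    intro x hx
    rw [Real.le_sqrt hx h0, le_div_iff₀ (by positivity), le_sub_iff_add_le, le_div_iff₀ hΓ,
      mul_comm]
  have hD0 : 0 ≤ Dh := by rw [hDh]; positivity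
  have hr0 := Real.sqrt_nonneg (B / Γth - H ^ 2)
  simp only [hfeas Dh hD0]
  simp only [fun q : EuclideanSpace ℝ (Fin 2) => hfeas ‖q - qt‖ (norm_nonneg _)]
  generalize Real.sqrt (B / Γth - H ^ 2) = r at *
  split_ifs with h
  · constructor
    · exact ⟨qu, by rw [← hDh]; exact h, by simp⟩
    · rintro _ ⟨q, -, rfl⟩
      simpa using hmono 0 ‖q - qu‖ le_rfl (norm_nonneg _)
  · push Not at h
    have hDpos : 0 < Dh := lt_of_le_of_lt hr0 h
    constructor
    · refine ⟨qt + (r / Dh) • (qu - qt), ?_, ?_⟩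
      · rw [add_sub_cancel_left, norm_smul, ← hDh, Real.norm_of_nonneg (by positivity)]
        exact (div_mul_cancel₀ _ hDpos.ne').le
      · have e : qt + (r / Dh) • (qu - qt) - qu = (r / Dh - 1) • (qu - qt) := by
          module
        have e2 : ‖qt + (r / Dh) • (qu - qt) - qu‖ ^ 2 = (Dh - r) ^ 2 := by
          rw [e, norm_smul, ← hDh, mul_pow, Real.norm_eq_abs, sq_abs]
          field_simp
          ring
        rw [e2]
    · rintro _ ⟨q, hq, rfl⟩
      apply hmono _ _ (by linarith)
      have := norm_sub_le_norm_sub_add_norm_sub qu q qt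
      rw [norm_sub_rev qu q, ← hDh] at this
      linarith
end

section
/- Let A > 0, B > 0, H > 0 and D_h > 0, and define R* : [0, B/H²] → ℝ by R*(Γ) = log₂(1 + A/H²) for 0 ≤ Γ ≤ B/(D_h² + H²), and R*(Γ) = log₂(1 + A/((D_h − √(B/Γ − H²))² + H²)) for B/(D_h² + H²) < Γ ≤ B/H². If D_h² > (4/3)·√(H² + A)·(√(4H² + A) − √(H² + A)), then the set C_sta = { (Γ, R) ∈ ℝ² : 0 ≤ Γ ≤ B/H² and R ≤ R*(Γ) } is not convex. -/
theorem aux_poly (A H t : ℝ) (hA : 0 < A) (hH : 0 < H) (ht : 0 < t)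
    (hcond : (2 * t) ^ 2 > (4 / 3) * Real.sqrt (H ^ 2 + A) *
        (Real.sqrt (4 * H ^ 2 + A) - Real.sqrt (H ^ 2 + A))) :
    0 < 3 * t ^ 4 + 2 * t ^ 2 * (H ^ 2 + A) - H ^ 2 * (H ^ 2 + A) := by
  have hs := Real.sq_sqrt (show 0 ≤ H ^ 2 + A by positivity)
  have hq := Real.sq_sqrt (show 0 ≤ 4 * H ^ 2 + A by positivity)
  have hs0 := Real.sqrt_nonneg (H ^ 2 + A)
  have hq0 := Real.sqrt_nonneg (4 * H ^ 2 + A)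
  set s := Real.sqrt (H ^ 2 + A)
  set q := Real.sqrt (4 * H ^ 2 + A)
  have h1 : s * q < 3 * t ^ 2 + (H ^ 2 + A) := by nlinarith
  have h2 : (s * q) ^ 2 < (3 * t ^ 2 + (H ^ 2 + A)) ^ 2 :=
    pow_lt_pow_left₀ h1 (by positivity) (by norm_num)
  rw [mul_pow, hs, hq] at h2
  nlinarith

theorem aux_F (A H t : ℝ) (hA : 0 < A) (hH : 0 < H) (ht : 0 < t)
    (hp : 0 < 3 * t ^ 4 + 2 * t ^ 2 * (H ^ 2 + A) - H ^ 2 * (H ^ 2 + A)) :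
    ∃ F' : ℝ, 0 < F' ∧ HasDerivAt (fun x : ℝ => (2 * t - x) * (x ^ 2 + H ^ 2) ^ 2 /
      (x * (((2 * t - x) ^ 2 + H ^ 2) * ((2 * t - x) ^ 2 + H ^ 2 + A)))) F' t := by
  have hy : HasDerivAt (fun x : ℝ => 2 * t - x) (-1) t := by
    simpa using (hasDerivAt_id t).const_sub (2 * t)
  have hx : HasDerivAt (fun x : ℝ => x) 1 t := hasDerivAt_id t
  have hn := hy.mul (((hx.pow 2).add_const (H ^ 2)).pow 2)
  have hd := hx.mul (((hy.pow 2).add_const (H ^ 2)).mul (((hy.pow 2).add_const (H ^ 2)).add_const A))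
  have hdn : t * (((2 * t - t) ^ 2 + H ^ 2) * ((2 * t - t) ^ 2 + H ^ 2 + A)) ≠ 0 := by positivity
  refine ⟨_, ?_, hn.div hd hdn⟩
  apply div_pos _ (by positivity)
  have e : 0 < 2 * t * (t ^ 2 + H ^ 2) ^ 2 *
    (3 * t ^ 4 + 2 * t ^ 2 * (H ^ 2 + A) - H ^ 2 * (H ^ 2 + A)) := by positivity
  refine lt_of_lt_of_eq e ?_
  simp only [Pi.mul_apply, Pi.pow_apply, Nat.cast_ofNat]
  norm_num
  ring

theorem aux_R (A B H D x : ℝ) (hA : 0 < A) (hB : 0 < B) (hH : 0 < H) (hx : 0 < x) :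
    HasDerivAt (fun Γ => Real.logb 2 (1 + A / ((D - Real.sqrt (B / Γ - H ^ 2)) ^ 2 + H ^ 2)))
      (-(A / (B * Real.log 2)) * ((D - x) * (x ^ 2 + H ^ 2) ^ 2 /
      (x * (((D - x) ^ 2 + H ^ 2) * ((D - x) ^ 2 + H ^ 2 + A))))) (B / (x ^ 2 + H ^ 2)) := by
  have hl : Real.log 2 ≠ 0 := (Real.log_pos (by norm_num)).ne'
  have hG : B / (x ^ 2 + H ^ 2) ≠ 0 := by positivity
  have e1 : B / (B / (x ^ 2 + H ^ 2)) - H ^ 2 = x ^ 2 := by field_simp; ring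
  have e2 : Real.sqrt (B / (B / (x ^ 2 + H ^ 2)) - H ^ 2) = x := by
    rw [e1, Real.sqrt_sq hx.le]
  have h1 := (((hasDerivAt_inv hG).const_mul B).sub_const (H ^ 2))
  have h1' : HasDerivAt (fun Γ => B / Γ - H ^ 2) (B * -((B / (x ^ 2 + H ^ 2)) ^ 2)⁻¹)
      (B / (x ^ 2 + H ^ 2)) := by simpa [div_eq_mul_inv] using h1
  have h2 := h1'.sqrt (by rw [e1]; positivity)
  have h3 := ((h2.const_sub D).pow 2).add_const (H ^ 2)
  have hpos : 0 < (D - x) ^ 2 + H ^ 2 := by positivity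
  have h4 := ((hasDerivAt_const (B / (x ^ 2 + H ^ 2)) A).div h3
    (by simp only [Pi.pow_apply]; rw [e2]; exact hpos.ne')).const_add 1
  have h5 := (h4.log (by
    simp only [Pi.div_apply, Pi.pow_apply]; rw [e2]; positivity)).div_const (Real.log 2)
  refine HasDerivAt.congr_deriv h5 ?_
  simp only [Pi.div_apply, Pi.pow_apply, e2]
  have : 0 < (D - x) ^ 2 + H ^ 2 + A := by positivity
  have h6 : 1 + A / ((D - x) ^ 2 + H ^ 2) = ((D - x) ^ 2 + H ^ 2 + A) / ((D - x) ^ 2 + H ^ 2) := by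
    field_simp
  rw [h6]
  generalize (D - x) ^ 2 + H ^ 2 + A = Q at *
  generalize (D - x) ^ 2 + H ^ 2 = P at *
  generalize D - x = y at *
  field_simp
  try ring

/-- Proposition 1: with the piecewise closed-form Pareto boundary `R*`, if
`D_h² > (4/3)·√(H² + A)·(√(4H² + A) − √(H² + A))`, the static achievable region
`C_sta = {(Γ, R) : 0 ≤ Γ ≤ B/H², R ≤ R*(Γ)}` is not convex. -/
theorem stmt_11 (A B H Dh : ℝ) (hA : 0 < A) (hB : 0 < B) (hH : 0 < H) (hDh : 0 < Dh)
    (Rstar : ℝ → ℝ)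
    (hRstar : Rstar = fun Γ =>
      if Γ ≤ B / (Dh ^ 2 + H ^ 2) then Real.logb 2 (1 + A / H ^ 2)
      else Real.logb 2 (1 + A / ((Dh - Real.sqrt (B / Γ - H ^ 2)) ^ 2 + H ^ 2)))
    (hcond : Dh ^ 2 > (4 / 3) * Real.sqrt (H ^ 2 + A) *
        (Real.sqrt (4 * H ^ 2 + A) - Real.sqrt (H ^ 2 + A))) :
    ¬ Convex ℝ {p : ℝ × ℝ | 0 ≤ p.1 ∧ p.1 ≤ B / H ^ 2 ∧ p.2 ≤ Rstar p.1} := by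
  intro hconv
  obtain ⟨t, rfl⟩ : ∃ t, Dh = 2 * t := ⟨Dh / 2, by ring⟩
  have ht : 0 < t := by linarith
  obtain ⟨F', hF', hF⟩ := aux_F A H t hA hH ht (aux_poly A H t hA hH ht hcond)
  have hl : 0 < Real.log 2 := Real.log_pos (by norm_num)
  -- concavity
  have hconc : ConvexOn ℝ (Set.Icc 0 (B / H ^ 2)) (fun x => - Rstar x) := by
    refine ⟨convex_Icc _ _, ?_⟩
    intro a ha b hb u v hu hv huv
    have := hconv (x := (a, Rstar a)) ⟨ha.1, ha.2, le_rfl⟩ (y := (b, Rstar b))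
      ⟨hb.1, hb.2, le_rfl⟩ hu hv huv
    have h := this.2.2
    simp only [Prod.smul_mk, Prod.mk_add_mk, smul_eq_mul] at h ⊢
    linarith
  have hmem : ∀ x ∈ Set.Ioo 0 (2 * t), B / (x ^ 2 + H ^ 2) ∈
      Set.Ioo (B / ((2 * t) ^ 2 + H ^ 2)) (B / H ^ 2) := by
    intro x hx
    have h0 := hx.1
    have h1 : x ^ 2 < (2 * t) ^ 2 := pow_lt_pow_left₀ hx.2 h0.le (by norm_num)
    constructor
    · apply div_lt_div_of_pos_left hB (by positivity); linarith
    · apply div_lt_div_of_pos_left hB (by positivity); nlinarith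
  have hder : ∀ x ∈ Set.Ioo 0 (2 * t), HasDerivAt (fun x => - Rstar x)
      (-(-(A / (B * Real.log 2)) * ((2 * t - x) * (x ^ 2 + H ^ 2) ^ 2 /
      (x * (((2 * t - x) ^ 2 + H ^ 2) * ((2 * t - x) ^ 2 + H ^ 2 + A))))))
      (B / (x ^ 2 + H ^ 2)) := by
    intro x hx
    refine ((aux_R A B H (2 * t) x hA hB hH hx.1).congr_of_eventuallyEq ?_).neg
    filter_upwards [lt_mem_nhds (hmem x hx).1] with y hy
    rw [hRstar]
    simp only [if_neg (not_le.mpr hy)]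
  have hsurj : ∀ y ∈ Set.Ioo (B / ((2 * t) ^ 2 + H ^ 2)) (B / H ^ 2),
      ∃ x ∈ Set.Ioo 0 (2 * t), B / (x ^ 2 + H ^ 2) = y := by
    intro y hy
    have hy0 : 0 < y := lt_trans (by positivity) hy.1
    have h1 : H ^ 2 < B / y := by
      have := hy.2
      rw [lt_div_iff₀ (by positivity)] at this ⊢; linarith
    have h2 : B / y < (2 * t) ^ 2 + H ^ 2 := by
      have := hy.1
      rw [div_lt_iff₀ (by positivity)] at this ⊢; linarith
    refine ⟨Real.sqrt (B / y - H ^ 2), ⟨Real.sqrt_pos.mpr (by linarith), ?_⟩, ?_⟩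
    · rw [Real.sqrt_lt' (by linarith)]; linarith
    · rw [Real.sq_sqrt (by linarith), sub_add_cancel, div_div_cancel₀ hB.ne']
  have hmono := (hconc.subset (show Set.Ioo (B / ((2 * t) ^ 2 + H ^ 2)) (B / H ^ 2) ⊆ Set.Icc 0 (B / H ^ 2) from
    fun y hy => ⟨le_trans (by positivity) hy.1.le, hy.2.le⟩) (convex_Ioo _ _)).monotoneOn_deriv
    (fun y hy => by
      obtain ⟨x, hx, rfl⟩ := hsurj y hy
      exact (hder x hx).differentiableAt)
  have hanti : AntitoneOn (fun x : ℝ => (2 * t - x) * (x ^ 2 + H ^ 2) ^ 2 /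
      (x * (((2 * t - x) ^ 2 + H ^ 2) * ((2 * t - x) ^ 2 + H ^ 2 + A)))) (Set.Ioo 0 (2 * t)) := by
    intro x hx z hz hxz
    have hle : B / (z ^ 2 + H ^ 2) ≤ B / (x ^ 2 + H ^ 2) := by
      have := hx.1
      gcongr
    have := hmono (hmem z hz) (hmem x hx) hle
    rw [(hder x hx).deriv, (hder z hz).deriv, neg_mul, neg_neg, neg_mul, neg_neg] at this
    exact le_of_mul_le_mul_left this (by positivity)
  have hnp := hanti.derivWithin_nonpos (x := t)
  have hmt : t ∈ Set.Ioo 0 (2 * t) := ⟨ht, by linarith⟩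
  rw [hF.hasDerivWithinAt.derivWithin (isOpen_Ioo.uniqueDiffWithinAt hmt)] at hnp
  linarith
end

section
/- Let A > 0, B > 0, H > 0 and D_h > 0 satisfy D_h² > (4/3)·√(H² + A)·(√(4H² + A) − √(H² + A)). Define f(Γ) = log₂(1 + A/((D_h − √(B/Γ − H²))² + H²)) on the open interval (B/(D_h² + H²), B/H²). Then f is not concave on this interval; in particular, there exists Γ in the interval at which the second derivative of f is strictly positive. -/
theorem aux_ineq (A H Dh : ℝ) (hA : 0 < A) (hH : 0 < H)
    (hcond : Dh ^ 2 > (4 / 3) * Real.sqrt (H ^ 2 + A) *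
        (Real.sqrt (4 * H ^ 2 + A) - Real.sqrt (H ^ 2 + A))) (d : ℝ) (hd : Dh = 2 * d) :
    ((d^2+H^2+A)*(d^2+H^2) - d^2*(3*(d^2+H^2+A)+(d^2+H^2))) < 0 := by
  have h1 : Real.sqrt (H ^ 2 + A) ^ 2 = H^2 + A := Real.sq_sqrt (by positivity)
  have h2 : Real.sqrt (4 * H ^ 2 + A) ^ 2 = 4 * H^2 + A := Real.sq_sqrt (by positivity)
  have p1 : 0 < Real.sqrt (H ^ 2 + A) := Real.sqrt_pos.2 (by positivity)
  have p2 : 0 < Real.sqrt (4 * H ^ 2 + A) := Real.sqrt_pos.2 (by positivity)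
  set k := Real.sqrt (H ^ 2 + A)
  set q := Real.sqrt (4 * H ^ 2 + A)
  subst hd
  have h3 : k * q < 3 * d^2 + k^2 := by nlinarith
  have h4 : (k*q)^2 < (3 * d^2 + k^2)^2 := by
    apply pow_lt_pow_left₀ h3 (by positivity) (by norm_num)
  have h5 : (k*q)^2 = (H^2+A)*(4*H^2+A) := by rw [mul_pow, h1, h2]
  rw [h5, h1] at h4
  nlinarith

theorem aux_first (A B H Dh : ℝ) (hA : 0 < A) (hB : 0 < B) (hH : 0 < H) 
    (x : ℝ) (hx : x ∈ Set.Ioo (B / (Dh ^ 2 + H ^ 2)) (B / H ^ 2)) :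
    0 < x ∧ 0 < B / x - H^2 ∧
    HasDerivAt (fun Γ => Real.sqrt (B / Γ - H ^ 2))
      (-(B / (2 * Real.sqrt (B / x - H ^ 2) * x^2))) x ∧
    HasDerivAt (fun Γ =>
      Real.logb 2 (1 + A / ((Dh - Real.sqrt (B / Γ - H ^ 2)) ^ 2 + H ^ 2)))
      (-(A * B / Real.log 2) * ((Dh - Real.sqrt (B / x - H ^ 2)) /
        ((((Dh - Real.sqrt (B / x - H ^ 2)) ^ 2 + H ^ 2 + A) *
         ((Dh - Real.sqrt (B / x - H ^ 2)) ^ 2 + H ^ 2)) *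
          (Real.sqrt (B / x - H ^ 2) * x ^ 2)))) x := by
  obtain ⟨h1, h2⟩ := hx
  have hx0 : 0 < x := lt_trans (by positivity) h1
  have h3 : 0 < B / x - H^2 := by
    rw [lt_div_iff₀ (by positivity)] at h2
    rw [sub_pos, lt_div_iff₀ hx0]; linarith
  have hs : HasDerivAt (fun Γ => Real.sqrt (B / Γ - H ^ 2))
      (-(B / (2 * Real.sqrt (B / x - H ^ 2) * x^2))) x := by
    have := (((hasDerivAt_const x B).div (hasDerivAt_id x) hx0.ne').sub_const (H^2)).sqrt h3.ne'
    have hp : 0 < Real.sqrt (B / x - H ^ 2) := Real.sqrt_pos.2 h3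
    refine this.congr_deriv ?_
    change (0 * x - B * 1) / x ^ 2 / (2 * Real.sqrt (B / x - H ^ 2)) = _
    generalize Real.sqrt (B / x - H ^ 2) = s at *
    field_simp
    ring
  refine ⟨hx0, h3, hs, ?_⟩
  have hsp : 0 < Real.sqrt (B / x - H ^ 2) := Real.sqrt_pos.2 h3
  have hM : 0 < (Dh - Real.sqrt (B / x - H ^ 2)) ^ 2 + H ^ 2 := by positivity
  have hu := ((hs.const_sub Dh).pow 2).add_const (H^2)
  have hl := (((((hasDerivAt_const x A).div hu hM.ne').const_add 1).log
    (by simp only [Pi.div_apply, Pi.pow_apply]; positivity)).div_const (Real.log 2))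
  refine hl.congr_deriv ?_
  simp only [Pi.div_apply, Pi.pow_apply]
  have hlog : 0 < Real.log 2 := Real.log_pos (by norm_num)
  generalize Real.sqrt (B / x - H ^ 2) = s at *
  have hM2 : 0 < (Dh - s) ^ 2 + H ^ 2 + A := by positivity
  field_simp
  push_cast
  ring

theorem aux_second (A B H Dh : ℝ) (hA : 0 < A) (hB : 0 < B) (hH : 0 < H) (hDh : 0 < Dh)
    (hcond : Dh ^ 2 > (4 / 3) * Real.sqrt (H ^ 2 + A) *
        (Real.sqrt (4 * H ^ 2 + A) - Real.sqrt (H ^ 2 + A))) :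
    ∃ x ∈ Set.Ioo (B / (Dh ^ 2 + H ^ 2)) (B / H ^ 2), 0 < deriv (deriv (fun Γ =>
      Real.logb 2 (1 + A / ((Dh - Real.sqrt (B / Γ - H ^ 2)) ^ 2 + H ^ 2)))) x := by
  obtain ⟨d, hd⟩ : ∃ d, Dh = 2 * d := ⟨Dh/2, by ring⟩
  have key := aux_ineq A H Dh hA hH hcond d hd
  have hd0 : 0 < d := by linarith
  have hmem : B / (d^2+H^2) ∈ Set.Ioo (B / (Dh ^ 2 + H ^ 2)) (B / H ^ 2) := by
    constructor
    · apply div_lt_div_of_pos_left hB (by positivity); subst hd; nlinarith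
    · apply div_lt_div_of_pos_left hB (by positivity); nlinarith
  refine ⟨_, hmem, ?_⟩
  have hev := Filter.eventually_of_mem (isOpen_Ioo.mem_nhds hmem)
    (fun x hx => (aux_first A B H Dh hA hB hH x hx).2.2.2.deriv)
  rw [Filter.EventuallyEq.deriv_eq hev]
  obtain ⟨hx0, h3, hs, -⟩ := aux_first A B H Dh hA hB hH _ hmem
  have hsv : Real.sqrt (B / (B / (d^2+H^2)) - H ^ 2) = d := by
    rw [div_div_cancel₀ hB.ne', add_sub_cancel_right, Real.sqrt_sq hd0.le]
  have hxv : B = (B / (d^2+H^2)) * (d^2+H^2) := by field_simp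
  generalize B / (d^2+H^2) = x at *
  rw [hsv] at hs
  have hu := hs.const_sub Dh
  have hM := (hu.pow 2).add_const (H^2)
  have hN := (hM.add_const A).mul hM
  have hD := hN.mul (hs.mul (hasDerivAt_pow 2 x))
  have hF := (hu.div hD (by
    simp only [Pi.mul_apply, Pi.pow_apply, hsv]; positivity)).const_mul (-(A * B / Real.log 2))
  have hF' := hF.deriv
  refine lt_of_lt_of_eq ?_ hF'.symm
  simp only [Pi.mul_apply, Pi.pow_apply, hsv]
  have hlog : 0 < Real.log 2 := Real.log_pos (by norm_num)
  rw [neg_mul, neg_pos]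
  apply mul_neg_of_pos_of_neg (by positivity)
  apply div_neg_of_neg_of_pos _ (by positivity)
  have e : Dh - d = d := by linarith
  rw [e]
  have : 0 < x ^ 2 := by positivity
  have hfin : ∀ T : ℝ, T = x * (d^2+H^2) * ((d^2+H^2+A)*(d^2+H^2) - d^2*(3*(d^2+H^2+A)+(d^2+H^2))) → T < 0 := by
    rintro T rfl
    exact mul_neg_of_pos_of_neg (by positivity) key
  apply hfin
  clear hF' hF hD hN hM hu hs hev hcond key hmem h3 hsv
  subst hxv
  field_simp
  push_cast
  ring

theorem stmt_12 (A B H Dh : ℝ) (hA : 0 < A) (hB : 0 < B) (hH : 0 < H) (hDh : 0 < Dh)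
    (hcond : Dh ^ 2 > (4 / 3) * Real.sqrt (H ^ 2 + A) *
        (Real.sqrt (4 * H ^ 2 + A) - Real.sqrt (H ^ 2 + A)))
    (f : ℝ → ℝ)
    (hf : f = fun Γ =>
      Real.logb 2 (1 + A / ((Dh - Real.sqrt (B / Γ - H ^ 2)) ^ 2 + H ^ 2))) :
    ¬ ConcaveOn ℝ (Set.Ioo (B / (Dh ^ 2 + H ^ 2)) (B / H ^ 2)) f ∧
    ∃ Γ ∈ Set.Ioo (B / (Dh ^ 2 + H ^ 2)) (B / H ^ 2), 0 < deriv (deriv f) Γ := by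
  obtain ⟨x, hx, hpos⟩ := aux_second A B H Dh hA hB hH hDh hcond
  rw [← hf] at hpos
  refine ⟨fun hc => ?_, x, hx, hpos⟩
  have hanti := hc.antitoneOn_deriv (fun y hy => by
    rw [hf]; exact (aux_first A B H Dh hA hB hH y hy).2.2.2.differentiableAt)
  have := hanti.derivWithin_nonpos (x := x)
  rw [derivWithin_of_isOpen isOpen_Ioo hx] at this
  linarith
end

section
/- Let A > 0, B > 0, H > 0 and D_h > 0, set Γ_min = B/(D_h² + H²) and Γ_max = B/H², and define f(Γ) = log₂(1 + A/((D_h − √(B/Γ − H²))² + H²)) on the open interval (Γ_min, Γ_max). Then there exists ε > 0 such that the second derivative of f is strictly negative on (Γ_min, Γ_min + ε) and on (Γ_max − ε, Γ_max); that is, f is strictly concave in a neighborhood of each endpoint of its domain. -/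
/-- numerator polynomial -/
noncomputable def auxP (A H D s : ℝ) : ℝ :=
  (D - s) * (s^2+H^2)^2 * ((((D-s)^2+H^2)*((D-s)^2+H^2+A))
      + s * (-(2*(D-s))*((D-s)^2+H^2+A) + ((D-s)^2+H^2)*(-(2*(D-s)))))
    - (-(s^2+H^2)^2 + (D-s)*(2*(s^2+H^2)*(2*s))) * (s * (((D-s)^2+H^2)*((D-s)^2+H^2+A)))

noncomputable def auxG (A B H D s : ℝ) : ℝ :=
  -(A/(B*Real.log 2)) * ((D - s) * (s^2+H^2)^2 / (s * (((D-s)^2+H^2)*((D-s)^2+H^2+A))))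

lemma aux_sder (B H x : ℝ) (hx : 0 < x) (h : 0 < B / x - H^2) :
    HasDerivAt (fun y => Real.sqrt (B / y - H^2)) (-B/x^2/(2*Real.sqrt (B / x - H^2))) x := by
  have h1 : HasDerivAt (fun y : ℝ => B / y - H^2) (-B/x^2) x := by
    have := ((hasDerivAt_const x B).div (hasDerivAt_id x) hx.ne').sub_const (H^2)
    refine HasDerivAt.congr_deriv this ?_
    simp
  exact h1.sqrt h.ne'

lemma aux_q (H D s : ℝ) : HasDerivAt (fun y : ℝ => (D-y)^2+H^2) (-(2*(D-s))) s := by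
  have := (((hasDerivAt_id s).const_sub D).pow 2).add_const (H^2)
  refine HasDerivAt.congr_deriv this ?_
  simp

lemma aux_gder (A H D s : ℝ) (hA : 0 < A) (hH : 0 < H) :
    HasDerivAt (fun y => Real.logb 2 (1 + A / ((D - y)^2+H^2)))
      (2*(D-s)*A/(((D-s)^2+H^2)*((D-s)^2+H^2+A)*Real.log 2)) s := by
  have hQ : 0 < (D-s)^2+H^2 := by positivity
  have hl : 0 < Real.log 2 := Real.log_pos (by norm_num)
  have h1 := (((hasDerivAt_const s A).div (aux_q H D s) hQ.ne').const_add 1).log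
    (by have : 0 < A / ((D-s)^2+H^2) := by positivity
        simp only [Pi.div_apply]; linarith)
  have h2 := h1.div_const (Real.log 2)
  refine HasDerivAt.congr_deriv h2 ?_
  simp only [Pi.div_apply]
  field_simp
  ring

lemma aux_Gder (A B H D s : ℝ) (hA : 0 < A) (hH : 0 < H) (hs : 0 < s) :
    HasDerivAt (auxG A B H D) ((A/(B*Real.log 2)) * (auxP A H D s /
      (s * (((D-s)^2+H^2)*((D-s)^2+H^2+A)))^2)) s := by
  have hQ : 0 < (D-s)^2+H^2 := by positivity
  have hR : s * (((D-s)^2+H^2)*((D-s)^2+H^2+A)) ≠ 0 := by positivity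
  have hq2 : HasDerivAt (fun y : ℝ => y^2+H^2) (2*s) s := by
    have := ((hasDerivAt_id s).pow 2).add_const (H^2)
    refine HasDerivAt.congr_deriv this ?_
    simp
  have h1 := ((hasDerivAt_id s).const_sub D).mul (hq2.pow 2)
  have h2 := (hasDerivAt_id s).mul ((aux_q H D s).mul ((aux_q H D s).add_const A))
  have h3 := (h1.div h2 hR).const_mul (-(A/(B*Real.log 2)))
  refine HasDerivAt.congr_deriv h3 ?_
  simp only [Pi.mul_apply, Pi.pow_apply, id, auxP]
  rw [neg_mul, ← mul_neg, ← neg_div]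
  congr 2
  push_cast
  ring

lemma aux_key (A B H D x : ℝ) (hA : 0 < A) (hB : 0 < B) (hH : 0 < H)
    (hx : 0 < x) (hx2 : x < B / H^2) (hP : 0 < auxP A H D (Real.sqrt (B / x - H^2))) :
    deriv (deriv (fun Γ =>
      Real.logb 2 (1 + A / ((D - Real.sqrt (B / Γ - H ^ 2)) ^ 2 + H ^ 2)))) x < 0 := by
  have hl : 0 < Real.log 2 := Real.log_pos (by norm_num)
  have hpos : ∀ y, 0 < y → y < B / H^2 → 0 < B / y - H^2 := by
    intro y hy hy2
    rw [lt_div_iff₀ (by positivity)] at hy2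
    rw [sub_pos, lt_div_iff₀ hy]
    linarith
  have hev : deriv (fun Γ =>
      Real.logb 2 (1 + A / ((D - Real.sqrt (B / Γ - H ^ 2)) ^ 2 + H ^ 2)))
      =ᶠ[nhds x] fun Γ => auxG A B H D (Real.sqrt (B / Γ - H^2)) := by
    filter_upwards [Ioo_mem_nhds hx hx2] with y hy
    have hp := hpos y hy.1 hy.2
    have h := (aux_gder A H D (Real.sqrt (B / y - H^2)) hA hH).comp y (aux_sder B H y hy.1 hp)
    refine Eq.trans h.deriv ?_
    have hs := Real.sqrt_pos.2 hp
    have hsq := Real.sq_sqrt hp.le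
    set s := Real.sqrt (B / y - H^2)
    have hQ : 0 < (D-s)^2+H^2 := by positivity
    have hy1 := hy.1
    have hsH : s^2+H^2 = B / y := by linarith
    unfold auxG
    rw [hsH]
    field_simp
  rw [hev.deriv_eq]
  have hp := hpos x hx hx2
  have hs := Real.sqrt_pos.2 hp
  have h := (aux_Gder A B H D _ hA hH hs).comp x (aux_sder B H x hx hp)
  have h' := h.deriv
  refine lt_of_eq_of_lt h' ?_
  set s := Real.sqrt (B / x - H^2)
  have hQ : 0 < (D-s)^2+H^2 := by positivity
  apply mul_neg_of_pos_of_neg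
  · positivity
  · rw [neg_div, neg_div]
    apply neg_neg_of_pos
    positivity

lemma aux_ev (A B H D x : ℝ) (hx : 0 < x)
    (hP : 0 < auxP A H D (Real.sqrt (B / x - H^2))) :
    ∀ᶠ y in nhds x, 0 < auxP A H D (Real.sqrt (B / y - H^2)) := by
  have hc : Continuous (auxP A H D) := by unfold auxP; fun_prop
  have h1 : ContinuousAt (fun y => Real.sqrt (B / y - H^2)) x :=
    ((continuousAt_const.div continuousAt_id hx.ne').sub continuousAt_const).sqrt
  exact (ContinuousAt.comp (f := fun y => Real.sqrt (B / y - H^2)) hc.continuousAt h1).eventually (lt_mem_nhds hP)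


/-- Appendix B, endpoint concavity: with `Γ_min = B/(D_h² + H²)` and
`Γ_max = B/H²`, the branch `f(Γ) = log₂(1 + A/((D_h − √(B/Γ − H²))² + H²))` has strictly
negative second derivative on `(Γ_min, Γ_min + ε)` and on `(Γ_max − ε, Γ_max)` for some
`ε > 0`. -/
theorem stmt_13 (A B H Dh : ℝ) (hA : 0 < A) (hB : 0 < B) (hH : 0 < H) (hDh : 0 < Dh)
    (Γmin Γmax : ℝ) (hmin : Γmin = B / (Dh ^ 2 + H ^ 2)) (hmax : Γmax = B / H ^ 2)
    (f : ℝ → ℝ)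
    (hf : f = fun Γ =>
      Real.logb 2 (1 + A / ((Dh - Real.sqrt (B / Γ - H ^ 2)) ^ 2 + H ^ 2))) :
    ∃ ε > 0,
      (∀ Γ ∈ Set.Ioo Γmin (Γmin + ε), deriv (deriv f) Γ < 0) ∧
      (∀ Γ ∈ Set.Ioo (Γmax - ε) Γmax, deriv (deriv f) Γ < 0) := by


  have hmin0 : 0 < Γmin := by rw [hmin]; positivity
  have hlt : Γmin < Γmax := by
    rw [hmin, hmax]
    apply div_lt_div_of_pos_left hB (by positivity)
    have : 0 < Dh^2 := by positivity
    linarith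
  have e1 : Real.sqrt (B / Γmin - H^2) = Dh := by
    rw [hmin, show B / (B / (Dh ^ 2 + H ^ 2)) - H^2 = Dh^2 by field_simp; ring]
    exact Real.sqrt_sq hDh.le
  have e2 : Real.sqrt (B / Γmax - H^2) = 0 := by
    rw [hmax, show B / (B / H ^ 2) - H^2 = 0 by field_simp; ring]
    exact Real.sqrt_zero
  have ev1 := aux_ev A B H Dh Γmin hmin0 (by
    rw [e1]
    have : auxP A H Dh Dh = (Dh^2+H^2)^2 * (Dh * (H^2*(H^2+A))) := by unfold auxP; ring
    rw [this]; positivity)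
  have ev2 := aux_ev A B H Dh Γmax (hmin0.trans hlt) (by
    rw [e2]
    have : auxP A H Dh 0 = Dh * (H^2)^2 * ((Dh^2+H^2)*(Dh^2+H^2+A)) := by unfold auxP; ring
    rw [this]; positivity)
  obtain ⟨a, ha, h1⟩ := Metric.eventually_nhds_iff.1 ev1
  obtain ⟨b, hb, h2⟩ := Metric.eventually_nhds_iff.1 ev2
  refine ⟨min (min a b) (Γmax - Γmin), by
    have := sub_pos.2 hlt
    positivity, ?_, ?_⟩
  · rintro x ⟨hx1, hx2⟩
    have i1 := min_le_left (min a b) (Γmax - Γmin)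
    have i2 := min_le_right (min a b) (Γmax - Γmin)
    have i3 := min_le_left a b
    rw [hf]
    apply aux_key A B H Dh x hA hB hH (by linarith) (by rw [← hmax]; linarith)
    apply h1
    rw [Real.dist_eq, abs_lt]
    constructor <;> linarith
  · rintro x ⟨hx1, hx2⟩
    have i1 := min_le_left (min a b) (Γmax - Γmin)
    have i2 := min_le_right (min a b) (Γmax - Γmin)
    have i3 := min_le_right a b
    rw [hf]
    apply aux_key A B H Dh x hA hB hH (by linarith) (by rw [← hmax]; linarith)
    apply h2
    rw [Real.dist_eq, abs_lt]
    constructor <;> linarith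
end

section
/- Let q_u, q_t ∈ ℝ², A > 0, B > 0, H > 0, V > 0, T > 0 and Γ_th > 0, and define R(q) = log₂(1 + A/(‖q − q_u‖² + H²)) and Γ(q) = B/(‖q − q_t‖² + H²) for q ∈ ℝ². Call a function q : [0, T] → ℝ² admissible if it is Lipschitz with constant V (i.e., ‖q(t) − q(s)‖ ≤ V·|t − s| for all s, t ∈ [0,T]) and satisfies (1/T)·∫₀ᵀ Γ(q(t)) dt ≥ Γ_th. Then for every admissible trajectory q there exist points q_a, q_b ∈ ℝ² and times τ_a, τ_b ≥ 0 with τ_a + τ_b + ‖q_a − q_b‖/V = T such that the hover–fly–hover trajectory q̂ — defined by q̂(t) = q_a for t ∈ [0, τ_a], q̂(t) = q_a + (V(t − τ_a)/‖q_b − q_a‖)·(q_b − q_a) for t ∈ [τ_a, τ_a + ‖q_a − q_b‖/V], and q̂(t) = q_b for t ∈ [τ_a + ‖q_a − q_b‖/V, T] (with q̂ constant when q_a = q_b) — is admissible and satisfies (1/T)·∫₀ᵀ R(q̂(t)) dt ≥ (1/T)·∫₀ᵀ R(q(t)) dt. -/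
/-- Hover–fly–hover trajectory: hover at `q_a` for time `τ_a`, fly to `q_b` at speed `V`
along the straight segment, then hover at `q_b` (constant when `q_a = q_b`). -/
noncomputable def hfh (V : ℝ) (qa qb : EuclideanSpace ℝ (Fin 2)) (τa : ℝ) (t : ℝ) :
    EuclideanSpace ℝ (Fin 2) :=
  if t ≤ τa then qa
  else if t ≤ τa + ‖qa - qb‖ / V then qa + ((V * (t - τa)) / ‖qb - qa‖) • (qb - qa)
  else qb

section aux
open MeasureTheory Set


lemma occ_aux (V T a b : ℝ) (hV : 0 < V) (hT : 0 < T) (hab : a ≤ b) (x : ℝ → ℝ)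
    (hx : ∀ s t, |x t - x s| ≤ V * |t - s|)
    (hsurj : Icc a b ⊆ x '' Icc 0 T) (hmaps : ∀ t ∈ Icc 0 T, x t ∈ Icc a b)
    (F : ℝ → ℝ) (hF : Continuous F) (hF0 : ∀ y ∈ Icc a b, 0 ≤ F y) :
    ∫ y in a..b, F y ≤ V * ∫ t in (0:ℝ)..T, F (x t) := by
  have hL : LipschitzWith (Real.toNNReal V) x := by
    apply LipschitzWith.of_dist_le_mul
    intro s t
    rw [Real.dist_eq, Real.dist_eq, Real.coe_toNNReal _ hV.le]
    exact hx t s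
  have hxc : Continuous x := hL.continuous
  have hxm : Measurable x := hxc.measurable
  have hle : (volume.restrict (Icc a b)) ≤
      (Real.toNNReal V) • Measure.map x (volume.restrict (Icc 0 T)) := by
    rw [Measure.le_iff]
    intro E hE
    rw [Measure.restrict_apply hE, Measure.smul_apply, Measure.map_apply hxm hE,
      Measure.restrict_apply (hxm hE)]
    have h1 : E ∩ Icc a b ⊆ x '' (x ⁻¹' E ∩ Icc 0 T) := by
      rintro y ⟨hyE, hy⟩
      obtain ⟨t, ht, rfl⟩ := hsurj hy
      exact ⟨t, ⟨hyE, ht⟩, rfl⟩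
    refine (measure_mono h1).trans ?_
    have h2 := hL.hausdorffMeasure_image_le (d := 1) zero_le_one (x ⁻¹' E ∩ Icc 0 T)
    rw [hausdorffMeasure_real] at h2
    simpa using h2
  rw [intervalIntegral.integral_of_le hab, intervalIntegral.integral_of_le hT.le,
    ← integral_Icc_eq_integral_Ioc, ← integral_Icc_eq_integral_Ioc]
  have hint : Integrable F (Measure.map x (volume.restrict (Icc 0 T))) := by
    rw [integrable_map_measure hF.aestronglyMeasurable hxm.aemeasurable]
    exact ((hF.comp hxc).continuousOn.integrableOn_Icc)
  have h3 := integral_mono_measure (f := F) hle ?_ ?_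
  · rw [integral_smul_nnreal_measure, integral_map hxm.aemeasurable hF.aestronglyMeasurable] at h3
    have : ∀ z : ℝ, (Real.toNNReal V) • z = V * z := by
      intro z
      rw [NNReal.smul_def, Real.coe_toNNReal _ hV.le, smul_eq_mul]
    rw [this] at h3
    exact h3
  · have : ∀ᵐ y ∂(Measure.map x (volume.restrict (Icc 0 T))), 0 ≤ F y := by
      rw [ae_map_iff hxm.aemeasurable (measurableSet_le measurable_const hF.measurable)]
      filter_upwards [ae_restrict_mem measurableSet_Icc] with t ht
      exact hF0 _ (hmaps t ht)
    exact Measure.ae_smul_measure this _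
  · exact hint.smul_measure_nnreal

lemma hfh_eq_aux (V α β τ t : ℝ) (hV : 0 < V) (hab : α ≤ β) (p e : EuclideanSpace ℝ (Fin 2))
    (he : ‖e‖ = 1) :
    hfh V (p + α • e) (p + β • e) τ t = p + (min β (max α (α + V * (t - τ)))) • e := by
  have h1 : (p + α • e) - (p + β • e) = (α - β) • e := by module
  have h2 : (p + β • e) - (p + α • e) = (β - α) • e := by module
  unfold hfh
  rw [h1, h2, norm_smul, norm_smul, he, mul_one, mul_one, Real.norm_eq_abs, Real.norm_eq_abs,
    abs_sub_comm, abs_of_nonneg (sub_nonneg.2 hab)]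
  split_ifs with h h'
  · have : V * (t - τ) ≤ 0 := mul_nonpos_of_nonneg_of_nonpos hV.le (by linarith)
    rw [max_eq_left (by linarith), min_eq_right hab]
  · have h3 : 0 < V * (t - τ) := mul_pos hV (by linarith)
    have h4 : V * (t - τ) ≤ β - α := by
      have : t - τ ≤ (β - α) / V := by linarith
      rw [le_div_iff₀ hV] at this
      linarith
    rw [max_eq_right (by linarith), min_eq_right (by linarith), smul_smul,
      div_mul_cancel₀ _ (by linarith : β - α ≠ 0)]
    module
  · have h4 : β - α ≤ V * (t - τ) := by
      have : (β - α) / V ≤ t - τ := by linarith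
      rw [div_le_iff₀ hV] at this
      linarith
    rw [max_eq_right (by linarith), min_eq_left (by linarith)]

lemma clamp_lip_aux (V α β τ s t : ℝ) (hV : 0 < V) :
    |min β (max α (α + V * (t - τ))) - min β (max α (α + V * (s - τ)))| ≤ V * |t - s| := by
  have h1 := abs_min_sub_min_le_max β (max α (α + V * (t - τ))) β (max α (α + V * (s - τ)))
  have h2 := abs_max_sub_max_le_max α (α + V * (t - τ)) α (α + V * (s - τ))
  have h3 : (α + V * (t - τ)) - (α + V * (s - τ)) = V * (t - s) := by ring
  rw [h3, abs_mul, abs_of_pos hV, sub_self, abs_zero,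
    max_eq_right (a := (0:ℝ)) (by positivity)] at h2
  rw [sub_self, abs_zero, max_eq_right (a := (0:ℝ)) (by positivity)] at h1
  exact h1.trans h2

lemma clamp_int_aux (V T α β τa τb : ℝ) (hV : 0 < V) (hab : α ≤ β) (ha : 0 ≤ τa) (hb : 0 ≤ τb)
    (hsum : τa + τb + (β - α) / V = T) (F : ℝ → ℝ) (hF : Continuous F) :
    ∫ t in (0:ℝ)..T, F (min β (max α (α + V * (t - τa)))) =
      τa * F α + (1 / V) * (∫ y in α..β, F y) + τb * F β := by
  have hc : Continuous fun t => F (min β (max α (α + V * (t - τa)))) := by fun_prop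
  have hd : 0 ≤ (β - α) / V := div_nonneg (by linarith) hV.le
  rw [← intervalIntegral.integral_add_adjacent_intervals (b := τa)
    (hc.intervalIntegrable _ _) (hc.intervalIntegrable _ _),
    ← intervalIntegral.integral_add_adjacent_intervals (a := τa) (b := τa + (β - α) / V) (c := T)
    (hc.intervalIntegrable _ _) (hc.intervalIntegrable _ _), ← add_assoc]
  congr 1
  · congr 1
    · rw [intervalIntegral.integral_congr (g := fun _ => F α)]
      · simp
      · intro t ht
        rw [uIcc_of_le ha] at ht
        have : V * (t - τa) ≤ 0 := mul_nonpos_of_nonneg_of_nonpos hV.le (by linarith [ht.2])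
        simp only
        rw [max_eq_left (by linarith), min_eq_right hab]
    · rw [intervalIntegral.integral_congr (g := fun t => F (V * t + (α - V * τa)))]
      · rw [intervalIntegral.integral_comp_mul_add F hV.ne']
        rw [smul_eq_mul, one_div]
        congr 2
        · ring
        · field_simp; ring
      · intro t ht
        rw [uIcc_of_le (by linarith)] at ht
        have h3 : 0 ≤ V * (t - τa) := mul_nonneg hV.le (by linarith [ht.1])
        have h4 : V * (t - τa) ≤ β - α := by
          have : t - τa ≤ (β - α) / V := by linarith [ht.2]
          rw [le_div_iff₀ hV] at this
          linarith
        simp only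
        rw [max_eq_right (by linarith), min_eq_right (by linarith)]
        congr 1; ring
  · rw [intervalIntegral.integral_congr (g := fun _ => F β)]
    · simp; left; linarith
    · intro t ht
      rw [uIcc_of_le (by linarith)] at ht
      have h4 : β - α ≤ V * (t - τa) := by
        have : (β - α) / V ≤ t - τa := by linarith [ht.1]
        rw [div_le_iff₀ hV] at this
        linarith
      simp only
      rw [max_eq_right (by linarith), min_eq_left (by linarith)]

lemma path_aux (V T a b p1 p2 G : ℝ) (hV : 0 < V) (hVT : b - a ≤ V * T)
    (h1 : a ≤ p1) (h12 : p1 ≤ p2) (h2 : p2 ≤ b) (g : ℝ → ℝ) (hg : Continuous g)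
    (hlo : (1 / V) * (∫ y in a..p1, g y) + (T - (p1 - a) / V) * g p1 ≤ G)
    (hhi : G ≤ (T - (b - p2) / V) * g p2 + (1 / V) * (∫ y in p2..b, g y)) :
    ∃ α β τa τb : ℝ, a ≤ α ∧ α ≤ β ∧ β ≤ b ∧ 0 ≤ τa ∧ 0 ≤ τb ∧ τa + τb + (β - α) / V = T ∧
      τa * g α + (1 / V) * (∫ y in α..β, g y) + τb * g β = G ∧
      (τa = 0 ∨ α = p1 ∨ α = p2) ∧ (τb = 0 ∨ β = p1 ∨ β = p2) := by
  have hdiv : ∀ c d, a ≤ c → d ≤ b → 0 ≤ T - (d - c) / V := by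
    intro c d hc hd
    have : (d - c) / V ≤ T := by rw [div_le_iff₀ hV]; linarith
    linarith
  have hi : ∀ c d, IntervalIntegrable g volume c d := fun c d => hg.intervalIntegrable c d
  have hprim : ∀ c, Continuous fun d => ∫ y in c..d, g y := fun c =>
    intervalIntegral.continuous_primitive hi c
  have hprim' : ∀ c, Continuous fun d => ∫ y in d..c, g y := by
    intro c
    have : (fun d => ∫ y in d..c, g y) = fun d => - ∫ y in c..d, g y := by
      funext d; rw [intervalIntegral.integral_symm]
    rw [this]; exact (hprim c).neg
  -- the two families: fly in from the left then hover, and hover then fly out to the right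
  have famL : ∀ c p, a ≤ c → c ≤ p → p ≤ b → (p = p1 ∨ p = p2) →
      (1 / V) * (∫ y in c..p, g y) + (T - (p - c) / V) * g p ≤ G → G ≤ T * g p →
      ∃ α β τa τb : ℝ, a ≤ α ∧ α ≤ β ∧ β ≤ b ∧ 0 ≤ τa ∧ 0 ≤ τb ∧ τa + τb + (β - α) / V = T ∧
      τa * g α + (1 / V) * (∫ y in α..β, g y) + τb * g β = G ∧
      (τa = 0 ∨ α = p1 ∨ α = p2) ∧ (τb = 0 ∨ β = p1 ∨ β = p2) := by
    intro c p hc hcp hp hpp hl hu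
    have hcont : Continuous fun z => (1 / V) * (∫ y in z..p, g y) + (T - (p - z) / V) * g p := by
      have := hprim' p
      fun_prop
    obtain ⟨z, hz, hzG⟩ := intermediate_value_Icc hcp hcont.continuousOn
      (show G ∈ Icc _ _ from ⟨hl, by simpa using hu⟩)
    refine ⟨z, p, 0, T - (p - z) / V, hc.trans hz.1, hz.2, hp, le_rfl,
      hdiv _ _ (hc.trans hz.1) hp, by ring, ?_, Or.inl rfl, Or.inr hpp⟩
    simp only at hzG
    linarith
  have famR : ∀ c p, a ≤ p → p ≤ c → c ≤ b → (p = p1 ∨ p = p2) →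
      G ≤ (T - (c - p) / V) * g p + (1 / V) * (∫ y in p..c, g y) → T * g p ≤ G →
      ∃ α β τa τb : ℝ, a ≤ α ∧ α ≤ β ∧ β ≤ b ∧ 0 ≤ τa ∧ 0 ≤ τb ∧ τa + τb + (β - α) / V = T ∧
      τa * g α + (1 / V) * (∫ y in α..β, g y) + τb * g β = G ∧
      (τa = 0 ∨ α = p1 ∨ α = p2) ∧ (τb = 0 ∨ β = p1 ∨ β = p2) := by
    intro c p hp hcp hc hpp hu hl
    have hcont : Continuous fun z => (T - (z - p) / V) * g p + (1 / V) * (∫ y in p..z, g y) := by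
      have := hprim p
      fun_prop
    obtain ⟨z, hz, hzG⟩ := intermediate_value_Icc hcp hcont.continuousOn
      (show G ∈ Icc _ _ from ⟨by simpa using hl, hu⟩)
    refine ⟨p, z, T - (z - p) / V, 0, hp, hz.1, hz.2.trans hc,
      hdiv _ _ hp (hz.2.trans hc), le_rfl, by ring, ?_, Or.inr hpp, Or.inl rfl⟩
    simp only at hzG
    linarith
  rcases le_total G (T * g p1) with hA | hA
  · exact famL a p1 le_rfl h1 (h12.trans h2) (Or.inl rfl) hlo hA
  rcases le_total G ((T - (p2 - p1) / V) * g p1 + (1 / V) * (∫ y in p1..p2, g y)) with hB | hB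
  · exact famR p2 p1 h1 h12 h2 (Or.inl rfl) hB hA
  rcases le_total (T * g p2) G with hC | hC
  · exact famR b p2 (h1.trans h12) h2 le_rfl (Or.inr rfl) hhi hC
  rcases le_total ((1 / V) * (∫ y in p1..p2, g y) + (T - (p2 - p1) / V) * g p2) G with hD | hD
  · exact famL p1 p2 h1 h12 h2 (Or.inr rfl) hD hC
  · have hm := hdiv p1 p2 h1 h2
    have hcont : Continuous fun τ : ℝ => (T - (p2 - p1) / V - τ) * g p1 +
        (1 / V) * (∫ y in p1..p2, g y) + τ * g p2 := by fun_prop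
    obtain ⟨z, hz, hzG⟩ := intermediate_value_Icc hm hcont.continuousOn
      (show G ∈ Icc _ _ from ⟨by simpa using hB, by simpa using hD⟩)
    refine ⟨p1, p2, T - (p2 - p1) / V - z, z, h1, h12, h2, by linarith [hz.2], hz.1, by ring,
      hzG, Or.inr (Or.inl rfl), Or.inr (Or.inr rfl)⟩

/-- Lagrange multiplier. -/
lemma mult_aux (a b s : ℝ) (has : a ≤ s) (hsb : s < b) (r g : ℝ → ℝ) (hr : Continuous r)
    (hg : Continuous g) (hra : AntitoneOn r (Icc a b)) (hgm : StrictMonoOn g (Icc a b)) :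
    ∃ l : ℝ, 0 ≤ l ∧ ∃ p1 ∈ Icc a s, ∃ p2 ∈ Icc s b,
      r p1 + l * g p1 = r p2 + l * g p2 ∧
      ∀ y ∈ Icc a b, r y + l * g y ≤ r p1 + l * g p1 := by
  have hcf : Continuous ↿(fun (l y : ℝ) => r y + l * g y) := by
    simp only [Function.HasUncurry.uncurry]
    fun_prop
  have c1 := (isCompact_Icc (a := a) (b := s)).continuous_sSup hcf
  have c2 := (isCompact_Icc (a := s) (b := b)).continuous_sSup hcf
  have n1 : (Icc a s).Nonempty := nonempty_Icc.2 has
  have n2 : (Icc s b).Nonempty := nonempty_Icc.2 hsb.le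
  have e1 : ∀ l : ℝ, ∃ p ∈ Icc a s, sSup ((fun y => r y + l * g y) '' Icc a s) = r p + l * g p ∧
      ∀ y ∈ Icc a s, r y + l * g y ≤ r p + l * g p := fun l =>
    isCompact_Icc.exists_sSup_image_eq_and_ge n1 (by fun_prop)
  have e2 : ∀ l : ℝ, ∃ p ∈ Icc s b, sSup ((fun y => r y + l * g y) '' Icc s b) = r p + l * g p ∧
      ∀ y ∈ Icc s b, r y + l * g y ≤ r p + l * g p := fun l =>
    isCompact_Icc.exists_sSup_image_eq_and_ge n2 (by fun_prop)
  have hgs : 0 < g b - g s := sub_pos.2 (hgm ⟨has, hsb.le⟩ ⟨has.trans hsb.le, le_rfl⟩ hsb)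
  have hrs : 0 ≤ r a - r b := sub_nonneg.2
    (hra ⟨le_rfl, has.trans hsb.le⟩ ⟨has.trans hsb.le, le_rfl⟩ (has.trans hsb.le))
  set L := (r a - r b) / (g b - g s) with hL
  have hL0 : 0 ≤ L := div_nonneg hrs hgs.le
  have hLm : L * (g b - g s) = r a - r b := div_mul_cancel₀ _ hgs.ne'
  have hcont := c2.sub c1
  obtain ⟨l, hl, hl0⟩ := intermediate_value_Icc hL0 hcont.continuousOn (show (0:ℝ) ∈ Icc _ _ by
    constructor
    · obtain ⟨p, hp, hpe, hpm⟩ := e1 0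
      obtain ⟨p', hp', hpe', hpm'⟩ := e2 0
      rw [Pi.sub_apply] 
      rw [hpe, hpe']
      have h1 := hpm s ⟨has, le_rfl⟩
      have h2 := hra (a := s) (b := p') ⟨has, hsb.le⟩ ⟨has.trans hp'.1, hp'.2⟩ hp'.1
      linarith
    · obtain ⟨p, hp, hpe, hpm⟩ := e1 L
      obtain ⟨p', hp', hpe', hpm'⟩ := e2 L
      rw [Pi.sub_apply] 
      rw [hpe, hpe']
      have h1 := hpm' b ⟨hsb.le, le_rfl⟩
      have h2 := hra (a := a) (b := p) ⟨le_rfl, has.trans hsb.le⟩ ⟨hp.1, hp.2.trans hsb.le⟩ hp.1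
      have h3 := hgm.monotoneOn (a := p) (b := s) ⟨hp.1, hp.2.trans hsb.le⟩ ⟨has, hsb.le⟩ hp.2
      have h4 := mul_le_mul_of_nonneg_left h3 hL0
      linarith)
  obtain ⟨p, hp, hpe, hpm⟩ := e1 l
  obtain ⟨p', hp', hpe', hpm'⟩ := e2 l
  rw [Pi.sub_apply, hpe, hpe'] at hl0
  refine ⟨l, hl.1, p, hp, p', hp', by linarith, fun y hy => ?_⟩
  rcases le_total y s with h | h
  · exact hpm y ⟨hy.1, h⟩
  · have := hpm' y ⟨h, hy.2⟩
    linarith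

lemma core_aux (V T a b : ℝ) (hV : 0 < V) (hT : 0 < T) (hab : a ≤ b) (hVT : b - a ≤ V * T)
    (x : ℝ → ℝ) (hx : Continuous x)
    (hI : ∀ F : ℝ → ℝ, Continuous F → (∀ y ∈ Icc a b, 0 ≤ F y) →
      ∫ y in a..b, F y ≤ V * ∫ t in (0:ℝ)..T, F (x t))
    (r g : ℝ → ℝ) (hr : Continuous r) (hg : Continuous g)
    (hra : AntitoneOn r (Icc a b)) (hgm : StrictMonoOn g (Icc a b)) :
    ∃ α β τa τb : ℝ, a ≤ α ∧ α ≤ β ∧ β ≤ b ∧ 0 ≤ τa ∧ 0 ≤ τb ∧ τa + τb + (β - α) / V = T ∧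
      τa * g α + (1 / V) * (∫ y in α..β, g y) + τb * g β = ∫ t in (0:ℝ)..T, g (x t) ∧
      ∫ t in (0:ℝ)..T, r (x t) ≤ τa * r α + (1 / V) * (∫ y in α..β, r y) + τb * r β := by
  have ii : ∀ (F : ℝ → ℝ), Continuous F → ∀ c d, IntervalIntegrable F volume c d :=
    fun F hF c d => hF.intervalIntegrable c d
  have hga : ∀ y ∈ Icc a b, g a ≤ g y := fun y hy =>
    hgm.monotoneOn ⟨le_rfl, hab⟩ hy hy.1
  have hgb : ∀ y ∈ Icc a b, g y ≤ g b := fun y hy =>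
    hgm.monotoneOn hy ⟨hab, le_rfl⟩ hy.2
  have hgx : Continuous fun t => g (x t) := hg.comp hx
  have hrx : Continuous fun t => r (x t) := hr.comp hx
  -- affine combination form of hI
  have hI' : ∀ k u v : ℝ, (∀ y ∈ Icc a b, 0 ≤ k + u * g y + v * r y) →
      (b - a) * k + u * (∫ y in a..b, g y) + v * (∫ y in a..b, r y) ≤
        V * (T * k + u * (∫ t in (0:ℝ)..T, g (x t)) + v * (∫ t in (0:ℝ)..T, r (x t))) := by
    intro k u v h
    have := hI (fun y => k + u * g y + v * r y) (by fun_prop) h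
    rw [intervalIntegral.integral_add (ii _ (by fun_prop) _ _) (ii _ (by fun_prop) _ _),
      intervalIntegral.integral_add (ii _ (by fun_prop) _ _) (ii _ (by fun_prop) _ _),
      intervalIntegral.integral_add (ii _ (by fun_prop) _ _) (ii _ (by fun_prop) _ _),
      intervalIntegral.integral_add (ii _ (by fun_prop) _ _) (ii _ (by fun_prop) _ _)] at this
    simpa using this
  set G := ∫ t in (0:ℝ)..T, g (x t) with hG
  set P := ∫ t in (0:ℝ)..T, r (x t) with hP
  have hm : 0 ≤ T - (b - a) / V := by
    have : (b - a) / V ≤ T := by rw [div_le_iff₀ hV]; linarith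
    linarith
  have hVi : V * (1 / V) = 1 := by field_simp
  have hVd : V * ((b - a) / V) = b - a := by field_simp
  have hIV : 0 < 1 / V := by positivity
  obtain ⟨s, hs, hsG⟩ : ∃ s ∈ Icc a b,
      (1 / V) * (∫ y in a..b, g y) + (T - (b - a) / V) * g s = G := by
    have hc : Continuous fun s => (1 / V) * (∫ y in a..b, g y) + (T - (b - a) / V) * g s := by
      fun_prop
    apply intermediate_value_Icc hab hc.continuousOn
    constructor
    · have h := hI' (- g a) 1 0 (fun y hy => by linarith [hga y hy])
      refine le_of_mul_le_mul_left ?_ hV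
      calc _ = V * (1 / V) * (∫ y in a..b, g y) + (V * T - V * ((b - a) / V)) * g a := by ring
        _ ≤ V * G := by rw [hVi, hVd]; linarith
    · have h := hI' (g b) (-1) 0 (fun y hy => by linarith [hgb y hy])
      refine le_of_mul_le_mul_left ?_ hV
      calc V * G ≤ V * (1 / V) * (∫ y in a..b, g y) + (V * T - V * ((b - a) / V)) * g b := by
            rw [hVi, hVd]; linarith
        _ = _ := by ring
  have hsG' : V * G = (∫ y in a..b, g y) + (V * T - (b - a)) * g s := by
    rw [← hsG]
    calc _ = V * (1 / V) * (∫ y in a..b, g y) + (V * T - V * ((b - a) / V)) * g s := by ring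
      _ = _ := by rw [hVi, hVd]; ring
  rcases hs.2.eq_or_lt with hsb | hsb
  · subst hsb
    refine ⟨a, s, 0, T - (s - a) / V, le_rfl, hab, le_rfl, le_rfl, hm, by ring, by linarith, ?_⟩
    refine le_of_forall_pos_le_add fun δ' hδ' => ?_
    set δ := δ' / T with hδ
    have hδ0 : 0 < δ := by positivity
    obtain ⟨K, hK⟩ : ∃ K : ℝ, ∀ y ∈ Icc a s, 0 ≤ (K * g s + δ + r s) + (-K) * g y + (-1) * r y := by
      obtain ⟨η, hη, hηs⟩ := Metric.continuousAt_iff.1 (hr.continuousAt (x := s)) δ hδ0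
      have hnear : ∀ y ∈ Icc a s, s - η < y → r y ≤ r s + δ := by
        intro y hy hys
        have := hηs (x := y) (by rw [Real.dist_eq, abs_lt]; constructor <;> linarith [hy.2])
        rw [Real.dist_eq, abs_lt] at this
        linarith [this.2]
      by_cases hc : a ≤ s - η
      · have hpos : 0 < g s - g (s - η) :=
          sub_pos.2 (hgm ⟨hc, by linarith⟩ ⟨hab, le_rfl⟩ (by linarith))
        have hrs : 0 ≤ r a - r s := sub_nonneg.2 (hra ⟨le_rfl, hab⟩ ⟨hab, le_rfl⟩ hab)
        set K := (r a - r s) / (g s - g (s - η)) with hKdef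
        have hK0 : 0 ≤ K := div_nonneg hrs hpos.le
        have hKm : K * (g s - g (s - η)) = r a - r s := div_mul_cancel₀ _ hpos.ne'
        refine ⟨K, fun y hy => ?_⟩
        rcases lt_or_ge (s - η) y with h | h
        · have h1 := hnear y hy h
          have h2 := mul_le_mul_of_nonneg_left (hgb y hy) hK0
          linarith
        · have h1 := hra ⟨le_rfl, hab⟩ hy hy.1
          have h2 := mul_le_mul_of_nonneg_left
            (hgm.monotoneOn hy ⟨hc, by linarith⟩ h) hK0
          linarith
      · refine ⟨0, fun y hy => ?_⟩
        have h1 := hnear y hy (by linarith [hy.1])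
        linarith
    have h := hI' _ _ _ hK
    have e : δ' = T * δ := by rw [hδ]; field_simp
    refine le_of_mul_le_mul_left ?_ hV
    calc V * P ≤ (∫ y in a..s, r y) + (V * T - (s - a)) * r s + V * (T * δ) := by
          have h5 : K * (V * G) = K * ((∫ y in a..s, g y) + (V * T - (s - a)) * g s) := by
            rw [hsG']
          have h6 : 0 ≤ (s - a) * δ := mul_nonneg (by linarith) hδ0.le
          linarith
      _ = V * (1 / V) * (∫ y in a..s, r y) + (V * T - V * ((s - a) / V)) * r s + V * (T * δ) := by
          rw [hVi, hVd]; ring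
      _ = _ := by rw [e]; ring
  · obtain ⟨l, hl, p1, hp1, p2, hp2, hpe, hpm⟩ := mult_aux a b s hs.1 hsb r g hr hg hra hgm
    have m1 : p1 ∈ Icc a b := ⟨hp1.1, hp1.2.trans hsb.le⟩
    have m2 : p2 ∈ Icc a b := ⟨hs.1.trans hp2.1, hp2.2⟩
    have hlow : (b - p1) * g p1 ≤ ∫ y in p1..b, g y := by
      have := intervalIntegral.integral_mono_on (f := fun _ => g p1) (g := g) m1.2
        (by simp) (ii g hg _ _)
        (fun y hy => hgm.monotoneOn m1 ⟨m1.1.trans hy.1, hy.2⟩ hy.1)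
      simpa using this
    have hupp : (∫ y in a..p2, g y) ≤ (p2 - a) * g p2 := by
      have := intervalIntegral.integral_mono_on (g := fun _ => g p2) (f := g) m2.1
        (ii g hg _ _) (by simp)
        (fun y hy => hgm.monotoneOn ⟨hy.1, hy.2.trans m2.2⟩ m2 hy.2)
      simpa using this
    have a1 := intervalIntegral.integral_add_adjacent_intervals (ii g hg a p1) (ii g hg p1 b)
    have a2 := intervalIntegral.integral_add_adjacent_intervals (ii g hg a p2) (ii g hg p2 b)
    have g1 : g p1 ≤ g s := hgm.monotoneOn m1 hs hp1.2
    have g2 : g s ≤ g p2 := hgm.monotoneOn hs m2 hp2.1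
    have hVm : 0 ≤ V * T - (b - a) := by linarith
    have k1 := mul_le_mul_of_nonneg_left g1 hVm
    have k2 := mul_le_mul_of_nonneg_left g2 hVm
    obtain ⟨α, β, τa, τb, hα, hαβ, hβ, hτa, hτb, hsum, hE, hoa, hob⟩ :=
      path_aux V T a b p1 p2 G hV hVT m1.1 (hp1.2.trans hp2.1) m2.2 g hg
      (by
        refine le_of_mul_le_mul_left ?_ hV
        calc _ = V * (1 / V) * (∫ y in a..p1, g y) + (V * T - V * ((p1 - a) / V)) * g p1 := by
              ring
          _ = (∫ y in a..p1, g y) + (V * T - (p1 - a)) * g p1 := by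
              rw [hVi, mul_div_cancel₀ _ hV.ne']; ring
          _ ≤ _ := by linarith)
      (by
        refine le_of_mul_le_mul_left ?_ hV
        calc V * G ≤ (∫ y in p2..b, g y) + (V * T - (b - p2)) * g p2 := by linarith
          _ = V * (1 / V) * (∫ y in p2..b, g y) + (V * T - V * ((b - p2) / V)) * g p2 := by
              rw [hVi, mul_div_cancel₀ _ hV.ne']; ring
          _ = _ := by ring)
    refine ⟨α, β, τa, τb, hα, hαβ, hβ, hτa, hτb, hsum, hE, ?_⟩
    set M := r p1 + l * g p1 with hM
    have fa : τa * (r α + l * g α) = τa * M := by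
      rcases hoa with h | h | h
      · rw [h]; simp
      · rw [h]
      · rw [h, ← hpe]
    have fb : τb * (r β + l * g β) = τb * M := by
      rcases hob with h | h | h
      · rw [h]; simp
      · rw [h]
      · rw [h, ← hpe]
    have h := hI' M (-l) (-1) (fun y hy => by linarith [hpm y hy])
    have hsub : (β - α) * M - l * (∫ y in α..β, g y) - (∫ y in α..β, r y) ≤
        (b - a) * M - l * (∫ y in a..b, g y) - (∫ y in a..b, r y) := by
      have h0 := intervalIntegral.integral_mono_interval (μ := volume)
        (f := fun y => M - l * g y - r y)
        hα hαβ hβ (by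
          filter_upwards [ae_restrict_mem measurableSet_Ioc] with y hy
          have := hpm y ⟨hy.1.le, hy.2⟩
          simp only [Pi.zero_apply]
          linarith) (ii _ (by fun_prop) _ _)
      rw [intervalIntegral.integral_sub (ii _ (by fun_prop) _ _) (ii _ (by fun_prop) _ _),
        intervalIntegral.integral_sub (ii _ (by fun_prop) _ _) (ii _ (by fun_prop) _ _),
        intervalIntegral.integral_sub (ii _ (by fun_prop) _ _) (ii _ (by fun_prop) _ _),
        intervalIntegral.integral_sub (ii _ (by fun_prop) _ _) (ii _ (by fun_prop) _ _)] at h0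
      simpa using h0
    refine le_of_mul_le_mul_left ?_ hV
    have hsum' : V * τa + V * τb + (β - α) = V * T := by
      rw [← hsum]; field_simp
    have hEV : V * (τa * g α) + (∫ y in α..β, g y) + V * (τb * g β) = V * G := by
      rw [← hE]
      calc _ = V * (τa * g α) + V * (1 / V) * (∫ y in α..β, g y) + V * (τb * g β) := by
            rw [hVi]; ring
        _ = _ := by ring
    have hlE : l * (V * (τa * g α) + (∫ y in α..β, g y) + V * (τb * g β)) = l * (V * G) := by
      rw [hEV]
    have hsM : (V * τa + V * τb + (β - α)) * M = V * T * M := by rw [hsum']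
    have fa' : V * (τa * (r α + l * g α)) = V * (τa * M) := by rw [fa]
    have fb' : V * (τb * (r β + l * g β)) = V * (τb * M) := by rw [fb]
    calc V * P ≤ V * (τa * r α) + (∫ y in α..β, r y) + V * (τb * r β) := by linarith
      _ = V * (τa * r α) + V * (1 / V) * (∫ y in α..β, r y) + V * (τb * r β) := by
          rw [hVi]; ring
      _ = _ := by ring

end aux

/-- Theorem 3, optimality of the HFH structure: for every trajectory
`q : [0,T] → ℝ²` that is `V`-Lipschitz and meets the average sensing constraint
`(1/T)∫₀ᵀ Γ(q(t))dt ≥ Γ_th`, there is a hover–fly–hover trajectory (hover at `q_a` for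
`τ_a`, fly at speed `V`, hover at `q_b` for `τ_b`, with `τ_a + τ_b + ‖q_a − q_b‖/V = T`)
that is also admissible and achieves an average rate at least that of `q`. -/
theorem stmt_15 (qu qt : EuclideanSpace ℝ (Fin 2)) (A B H V T Γth : ℝ)
    (hA : 0 < A) (hB : 0 < B) (hH : 0 < H) (hV : 0 < V) (hT : 0 < T) (hΓth : 0 < Γth)
    (R Γ : EuclideanSpace ℝ (Fin 2) → ℝ)
    (hR : R = fun q => Real.logb 2 (1 + A / (‖q - qu‖ ^ 2 + H ^ 2)))
    (hΓ : Γ = fun q => B / (‖q - qt‖ ^ 2 + H ^ 2)) :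
    ∀ q : ℝ → EuclideanSpace ℝ (Fin 2),
      (∀ s ∈ Set.Icc (0 : ℝ) T, ∀ t ∈ Set.Icc (0 : ℝ) T, ‖q t - q s‖ ≤ V * |t - s|) →
      (Γth ≤ (1 / T) * ∫ t in (0 : ℝ)..T, Γ (q t)) →
      ∃ qa qb : EuclideanSpace ℝ (Fin 2), ∃ τa τb : ℝ,
        0 ≤ τa ∧ 0 ≤ τb ∧ τa + τb + ‖qa - qb‖ / V = T ∧
        (∀ s ∈ Set.Icc (0 : ℝ) T, ∀ t ∈ Set.Icc (0 : ℝ) T,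
          ‖hfh V qa qb τa t - hfh V qa qb τa s‖ ≤ V * |t - s|) ∧
        (Γth ≤ (1 / T) * ∫ t in (0 : ℝ)..T, Γ (hfh V qa qb τa t)) ∧
        ((1 / T) * ∫ t in (0 : ℝ)..T, R (q t)
          ≤ (1 / T) * ∫ t in (0 : ℝ)..T, R (hfh V qa qb τa t)) := by
  intro q hq hΓq
  obtain ⟨e, he, hqt⟩ : ∃ e : EuclideanSpace ℝ (Fin 2), ‖e‖ = 1 ∧ qt = qu + ‖qt - qu‖ • e := by
    by_cases h : qt - qu = 0
    · refine ⟨EuclideanSpace.single 0 1, by simp, ?_⟩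
      rw [h]; simp [sub_eq_zero.1 h]
    · refine ⟨(‖qt - qu‖)⁻¹ • (qt - qu), ?_, ?_⟩
      · rw [norm_smul, norm_inv, norm_norm, inv_mul_cancel₀ (norm_ne_zero_iff.2 h)]
      · rw [smul_smul, mul_inv_cancel₀ (norm_ne_zero_iff.2 h)]; simp
  set D := ‖qt - qu‖ with hD
  have hD0 : 0 ≤ D := norm_nonneg _
  have hee : inner ℝ e e = 1 := by rw [real_inner_self_eq_norm_sq, he]; norm_num
  -- clamped time and projected trajectory
  set cl : ℝ → ℝ := fun t => max 0 (min T t) with hcl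
  have clmem : ∀ t, cl t ∈ Set.Icc (0:ℝ) T := fun t =>
    ⟨le_max_left _ _, max_le hT.le (min_le_left _ _)⟩
  have cleq : ∀ t ∈ Set.Icc (0:ℝ) T, cl t = t := by
    intro t ht
    simp only [hcl]
    rw [min_eq_right ht.2, max_eq_right ht.1]
  have cllip : ∀ s t, |cl t - cl s| ≤ |t - s| := by
    intro s t
    have h1 := abs_max_sub_max_le_max 0 (min T t) 0 (min T s)
    have h2 := abs_min_sub_min_le_max T t T s
    rw [sub_self, abs_zero, max_eq_right (a := (0:ℝ)) (abs_nonneg _)] at h1 h2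
    exact h1.trans h2
  have qlip : ∀ s t, ‖q (cl t) - q (cl s)‖ ≤ V * |t - s| := fun s t =>
    (hq _ (clmem s) _ (clmem t)).trans (mul_le_mul_of_nonneg_left (cllip s t) hV.le)
  have qcont : Continuous fun t => q (cl t) := by
    have : LipschitzWith (Real.toNNReal V) fun t => q (cl t) := by
      apply LipschitzWith.of_dist_le_mul
      intro s t
      rw [dist_eq_norm, Real.dist_eq, Real.coe_toNNReal _ hV.le]
      exact qlip t s
    exact this.continuous
  set x : ℝ → ℝ := fun t => max 0 (min D (inner ℝ (q (cl t) - qu) e)) with hxdef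
  have xlip : ∀ s t, |x t - x s| ≤ V * |t - s| := by
    intro s t
    have h1 := abs_max_sub_max_le_max 0 (min D (inner ℝ (q (cl t) - qu) e)) 0
      (min D (inner ℝ (q (cl s) - qu) e))
    have h2 := abs_min_sub_min_le_max D (inner ℝ (q (cl t) - qu) e) D
      (inner ℝ (q (cl s) - qu) e)
    rw [sub_self, abs_zero, max_eq_right (a := (0:ℝ)) (abs_nonneg _)] at h1 h2
    refine (h1.trans h2).trans (le_trans ?_ (qlip s t))
    rw [← inner_sub_left]
    have h3 := abs_real_inner_le_norm (q (cl t) - qu - (q (cl s) - qu)) e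
    rw [he, mul_one] at h3
    simpa using h3
  have xcont : Continuous x := by
    exact continuous_const.max (continuous_const.min
      ((qcont.sub continuous_const).inner continuous_const))
  have x0 : ∀ t, 0 ≤ x t := fun t => le_max_left _ _
  have xD : ∀ t, x t ≤ D := fun t => max_le hD0 (min_le_left _ _)
  -- distances shrink
  have du : ∀ t, (x t) ^ 2 ≤ ‖q (cl t) - qu‖ ^ 2 := by
    intro t
    have h3 := abs_real_inner_le_norm (q (cl t) - qu) e
    rw [he, mul_one] at h3
    refine pow_le_pow_left₀ (x0 t) (max_le (norm_nonneg _) ?_) 2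
    exact (min_le_right _ _).trans ((le_abs_self _).trans h3)
  have dt : ∀ t, (x t - D) ^ 2 ≤ ‖q (cl t) - qt‖ ^ 2 := by
    intro t
    have h3 := abs_real_inner_le_norm (q (cl t) - qt) e
    rw [he, mul_one] at h3
    have h4 : inner ℝ (q (cl t) - qt) e = inner ℝ (q (cl t) - qu) e - D := by
      have : q (cl t) - qt = (q (cl t) - qu) - D • e := by
        rw [hqt]; abel
      rw [this, inner_sub_left, inner_smul_left, hee]; simp
    rw [h4] at h3
    rw [← abs_of_nonneg (norm_nonneg (q (cl t) - qt)), sq_abs, ← sq_abs]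
    refine pow_le_pow_left₀ (abs_nonneg _) ?_ 2
    rw [abs_of_nonpos (by linarith [xD t])]
    have h5 := neg_abs_le (inner ℝ (q (cl t) - qu) e - D)
    have h6 : min D (inner ℝ (q (cl t) - qu) e) ≤ x t := le_max_right _ _
    rcases min_choice D (inner ℝ (q (cl t) - qu) e) with h | h
    · rw [h] at h6; linarith [norm_nonneg (q (cl t) - qt)]
    · rw [h] at h6; linarith
  have hH2 : 0 < H ^ 2 := by positivity
  set r : ℝ → ℝ := fun y => Real.logb 2 (1 + A / (y ^ 2 + H ^ 2)) with hrdef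
  set g : ℝ → ℝ := fun y => B / ((y - D) ^ 2 + H ^ 2) with hgdef
  have logmono : ∀ u v : ℝ, 0 ≤ u → u ≤ v →
      Real.logb 2 (1 + A / (v + H ^ 2)) ≤ Real.logb 2 (1 + A / (u + H ^ 2)) := by
    intro u v hu huv
    have hv := hu.trans huv
    apply Real.logb_le_logb_of_le (by norm_num) (by positivity)
    gcongr
  have logcont : ∀ {X : Type} [TopologicalSpace X] (k : X → ℝ), Continuous k →
      Continuous fun z => Real.logb 2 (1 + A / ((k z) ^ 2 + H ^ 2)) := by
    intro X _ k hk
    have hne : ∀ z, (k z) ^ 2 + H ^ 2 ≠ 0 := fun z => by positivity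
    have hne' : ∀ z, 1 + A / ((k z) ^ 2 + H ^ 2) ≠ 0 := fun z => by positivity
    simp only [Real.logb]
    exact (Continuous.log (continuous_const.add (continuous_const.div (by fun_prop) hne))
      hne').div_const _
  have gamcont : ∀ {X : Type} [TopologicalSpace X] (k : X → ℝ), Continuous k →
      Continuous fun z => B / ((k z) ^ 2 + H ^ 2) := by
    intro X _ k hk
    exact continuous_const.div (by fun_prop) (fun z => by positivity)
  have rcont : Continuous r := logcont _ continuous_id
  have gcont : Continuous g := gamcont _ (by fun_prop)
  have Rqcont : Continuous fun t => R (q (cl t)) := by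
    rw [hR]; exact logcont (fun t => ‖q (cl t) - qu‖) (qcont.sub continuous_const).norm
  have Γqcont : Continuous fun t => Γ (q (cl t)) := by
    rw [hΓ]; exact gamcont (fun t => ‖q (cl t) - qt‖) (qcont.sub continuous_const).norm
  have Rle : ∫ t in (0:ℝ)..T, R (q t) ≤ ∫ t in (0:ℝ)..T, r (x t) := by
    rw [intervalIntegral.integral_congr (g := fun t => R (q (cl t)))]
    · apply intervalIntegral.integral_mono_on hT.le (Rqcont.intervalIntegrable _ _)
        ((rcont.comp xcont).intervalIntegrable _ _)
      intro t _
      rw [hR]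
      exact logmono _ _ (sq_nonneg _) (du t)
    · intro t ht
      rw [Set.uIcc_of_le hT.le] at ht
      simp only [cleq t ht]
  have Γle : ∫ t in (0:ℝ)..T, Γ (q t) ≤ ∫ t in (0:ℝ)..T, g (x t) := by
    rw [intervalIntegral.integral_congr (g := fun t => Γ (q (cl t)))]
    · apply intervalIntegral.integral_mono_on hT.le (Γqcont.intervalIntegrable _ _)
        ((gcont.comp xcont).intervalIntegrable _ _)
      intro t _
      rw [hΓ]
      exact div_le_div_of_nonneg_left hB.le (by positivity) (add_le_add_left (dt t) _)
    · intro t ht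
      rw [Set.uIcc_of_le hT.le] at ht
      simp only [cleq t ht]
  have Rline : ∀ y, R (qu + y • e) = r y := by
    intro y
    simp only [hR, hrdef, add_sub_cancel_left, norm_smul, he, mul_one, Real.norm_eq_abs, sq_abs]
  have Γline : ∀ y, Γ (qu + y • e) = g y := by
    intro y
    have : qu + y • e - qt = (y - D) • e := by rw [hqt]; module
    simp only [hΓ, hgdef, this, norm_smul, he, mul_one, Real.norm_eq_abs, sq_abs]
  -- range of x
  obtain ⟨ta, hta, hmin⟩ := isCompact_Icc.exists_isMinOn (Set.nonempty_Icc.2 hT.le)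
    (xcont.continuousOn (s := Set.Icc 0 T))
  obtain ⟨tb, htb, hmax⟩ := isCompact_Icc.exists_isMaxOn (Set.nonempty_Icc.2 hT.le)
    (xcont.continuousOn (s := Set.Icc 0 T))
  have hab : x ta ≤ x tb := hmin htb
  have hmaps : ∀ t ∈ Set.Icc 0 T, x t ∈ Set.Icc (x ta) (x tb) := fun t ht => ⟨hmin ht, hmax ht⟩
  have hsurj : Set.Icc (x ta) (x tb) ⊆ x '' Set.Icc 0 T :=
    (isPreconnected_Icc.image x xcont.continuousOn).ordConnected.out ⟨ta, hta, rfl⟩ ⟨tb, htb, rfl⟩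
  have hVT : x tb - x ta ≤ V * T := by
    refine (le_abs_self _).trans ((xlip ta tb).trans (mul_le_mul_of_nonneg_left ?_ hV.le))
    rw [abs_le]; constructor <;> linarith [hta.1, hta.2, htb.1, htb.2]
  obtain ⟨α, β, τa, τb, hα, hαβ, hβ, hτa, hτb, hsum, hgE, hrE⟩ :=
    core_aux V T (x ta) (x tb) hV hT hab hVT x xcont
      (fun F hF hF0 => occ_aux V T _ _ hV hT hab x xlip hsurj hmaps F hF hF0) r g rcont gcont
      (by
        intro y hy z hz hyz
        have hy0 : 0 ≤ y := (x0 ta).trans hy.1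
        exact logmono _ _ (sq_nonneg _) (pow_le_pow_left₀ hy0 hyz 2))
      (by
        intro y hy z hz hyz
        have hzD : z ≤ D := hz.2.trans (xD tb)
        have : (z - D) ^ 2 < (y - D) ^ 2 := by nlinarith
        simp only [hgdef]
        gcongr)
  have hform := fun t => hfh_eq_aux V α β τa t hV hαβ qu e he
  have hnorm : ‖(qu + α • e) - (qu + β • e)‖ = β - α := by
    have h1 : (qu + α • e) - (qu + β • e) = (α - β) • e := by module
    rw [h1, norm_smul, he, mul_one, Real.norm_eq_abs, abs_sub_comm,
      abs_of_nonneg (sub_nonneg.2 hαβ)]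
  have hT' : 0 ≤ 1 / T := by positivity
  refine ⟨qu + α • e, qu + β • e, τa, τb, hτa, hτb, by rw [hnorm]; exact hsum, ?_, ?_, ?_⟩
  · intro s _ t _
    rw [hform, hform, add_sub_add_left_eq_sub, ← sub_smul, norm_smul, he, mul_one,
      Real.norm_eq_abs]
    exact clamp_lip_aux V α β τa s t hV
  · simp only [hform, Γline]
    rw [clamp_int_aux V T α β τa τb hV hαβ hτa hτb hsum g gcont, hgE]
    exact hΓq.trans (mul_le_mul_of_nonneg_left Γle hT')
  · simp only [hform, Rline]
    rw [clamp_int_aux V T α β τa τb hV hαβ hτa hτb hsum r rcont]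
    exact mul_le_mul_of_nonneg_left (Rle.trans hrE) hT'
end
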